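/- arXiv:1612.03408 — 2 statements merged into one kernel-verified Lean document; each statement's English description precedes it below -/
import Mathlib

section
/- Let A and B be commutative rings, f : A → B a ring homomorphism, and J an ideal of B such that the embedding ι_A : A → A⋈^f J is an integral ring extension. If A is Cohen-Macaulay in the sense of ideals and kgr_A(𝔞, J) ≥ height 𝔞 for every ideal 𝔞 of A, then A⋈^f J is Cohen-Macaulay in the sense of ideals. -/
/-- The Koszul cochain differential of the complex `Hom(K_•(x), M)`, described explicitly:
the degree-`i` term is the module of `M`-valued functions on the `i`-element subsets of
`Fin n`, and the differential is the usual alternating-sum formula. -/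
noncomputable def koszulMap (A : Type*) [CommRing A] (M : Type*) [AddCommGroup M]
    [Module A M] {n : ℕ} (x : Fin n → A) (i : ℕ) :
    ({s : Finset (Fin n) // s.card = i} → M) →ₗ[A]
      ({s : Finset (Fin n) // s.card = i + 1} → M) where
  toFun g t := ∑ j ∈ t.1.attach,
    (((-1 : A) ^ ((t.1.filter (fun k => k < j.1)).card)) * x j.1) •
      g ⟨t.1.erase j.1, by
        rw [Finset.card_erase_of_mem j.2, t.2]; omega⟩

  map_add' g h := funext fun t => by
    simp [smul_add, Finset.sum_add_distrib]
  map_smul' a g := funext fun t => by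
    simp only [Pi.smul_apply, RingHom.id_apply, Finset.smul_sum]
    exact Finset.sum_congr rfl fun j _ => by
      rw [smul_smul, smul_smul, mul_comm]

/-- Nonvanishing of the `i`-th cohomology `H^i(Hom(K_•(x), M))` of the Koszul
cochain complex. -/
def koszulCohomologyNeZero (A : Type*) [CommRing A] (M : Type*) [AddCommGroup M]
    [Module A M] {n : ℕ} (x : Fin n → A) : ℕ → Prop
  | 0 => LinearMap.ker (koszulMap A M x 0) ≠ ⊥
  | (i + 1) => ¬ (LinearMap.ker (koszulMap A M x (i + 1)) ≤
      LinearMap.range (koszulMap A M x i))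

/-- The Koszul grade of a finite sequence `x` on `M`:
`inf { i : H^i(Hom(K_•(x), M)) ≠ 0 }` (an element of `ℕ∞`, equal to `⊤` if all
cohomology vanishes). -/
noncomputable def kgrSeq (A : Type*) [CommRing A] (M : Type*) [AddCommGroup M]
    [Module A M] {n : ℕ} (x : Fin n → A) : ℕ∞ :=
  sInf {i : ℕ∞ | ∃ k : ℕ, i = k ∧ koszulCohomologyNeZero A M x k}

/-- The Koszul grade `kgr_A(𝔞, M)` of an arbitrary ideal `𝔞` on `M`: the supremum of the
Koszul grades of finite sequences contained in `𝔞` (equivalently, of the finitely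
generated subideals of `𝔞`). -/
noncomputable def kgr (A : Type*) [CommRing A] (𝔞 : Ideal A) (M : Type*)
    [AddCommGroup M] [Module A M] : ℕ∞ :=
  ⨆ (n : ℕ) (x : Fin n → A) (_ : ∀ j, x j ∈ 𝔞), kgrSeq A M x

/-- The height of an ideal: the infimum of the heights of the primes containing it. -/
noncomputable def idealHeight (A : Type*) [CommRing A] (𝔞 : Ideal A) : ℕ∞ :=
  ⨅ (p : PrimeSpectrum A) (_ : 𝔞 ≤ p.asIdeal), Order.height p

/-- A commutative ring `R` is Cohen-Macaulay in the sense of a class `𝒜` of ideals if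
`height 𝔞 = kgr_R(𝔞, R)` for every `𝔞 ∈ 𝒜`. -/
def IsCMSense (R : Type*) [CommRing R] (𝒜 : Set (Ideal R)) : Prop :=
  ∀ 𝔞 ∈ 𝒜, idealHeight R 𝔞 = kgr R 𝔞 R

/-- Cohen-Macaulay in the sense of ideals. -/
def IsCMIdeals (R : Type*) [CommRing R] : Prop :=
  ∀ 𝔞 : Ideal R, idealHeight R 𝔞 = kgr R 𝔞 R

/-- Cohen-Macaulay in the sense of maximal ideals. -/
def IsCMMaximal (R : Type*) [CommRing R] : Prop :=
  ∀ 𝔪 : Ideal R, 𝔪.IsMaximal → idealHeight R 𝔪 = kgr R 𝔪 R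

/-- The amalgamation `A ⋈^f J = {(a, f a + j) : a ∈ A, j ∈ J}` of `A` with `B` along the
ideal `J` of `B` with respect to `f : A →+* B`, as a subring of `A × B`. -/
def amalgamation {A B : Type*} [CommRing A] [CommRing B] (f : A →+* B) (J : Ideal B) :
    Subring (A × B) where
  carrier := {p | p.2 - f p.1 ∈ J}
  zero_mem' := by simp
  one_mem' := by simp
  add_mem' := fun {p q} hp hq => by
    have := J.add_mem hp hq
    simpa [add_sub_add_comm] using this
  neg_mem' := fun {p} hp => by
    show (-p).2 - f ((-p).1) ∈ J
    have key : (-p).2 - f ((-p).1) = -(p.2 - f p.1) := by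
      simp only [Prod.fst_neg, Prod.snd_neg, map_neg]; ring
    rw [key]
    exact J.neg_mem hp
  mul_mem' := fun {p q} hp hq => by
    show (p * q).2 - f ((p * q).1) ∈ J
    have key : (p * q).2 - f ((p * q).1)
        = p.2 * (q.2 - f q.1) + (p.2 - f p.1) * f q.1 := by
      simp only [Prod.fst_mul, Prod.snd_mul, map_mul]; ring
    rw [key]
    exact J.add_mem (J.mul_mem_left _ hq) (J.mul_mem_right _ hp)

/-- The natural embedding `ι_A : A → A ⋈^f J`, `a ↦ (a, f a)`. -/
def amalgIota {A B : Type*} [CommRing A] [CommRing B] (f : A →+* B) (J : Ideal B) :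
    A →+* amalgamation f J where
  toFun a := ⟨(a, f a), show (a, f a).2 - f (a, f a).1 ∈ J by simp⟩
  map_one' := Subtype.ext (by simp)
  map_mul' a b := Subtype.ext (by simp)
  map_zero' := Subtype.ext (by simp)
  map_add' a b := Subtype.ext (by simp)

/-- The extension `𝔞^e = 𝔞(A ⋈^f J)` of an ideal `𝔞` of `A` along `ι_A`. -/
noncomputable def idealExt {A B : Type*} [CommRing A] [CommRing B] (f : A →+* B)
    (J : Ideal B) (𝔞 : Ideal A) : Ideal ↥(amalgamation f J) :=
  Ideal.map (amalgIota f J) 𝔞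

/-- `kgr_A(𝔞, J)` where the ideal `J` of `B` is viewed as an `A`-module via `f`. -/
noncomputable def kgrIdeal {A B : Type*} [CommRing A] [CommRing B] (f : A →+* B)
    (J : Ideal B) (𝔞 : Ideal A) : ℕ∞ :=
  letI : Module A J := Module.compHom J f
  kgr A 𝔞 J

/-- The ideal `𝔭'^f = 𝔭 ⋈^f J = {(p, f p + j) : p ∈ 𝔭, j ∈ J}` of `A ⋈^f J`. -/
def primeAmalg {A B : Type*} [CommRing A] [CommRing B] (f : A →+* B) (J : Ideal B)
    (𝔭 : Ideal A) : Ideal ↥(amalgamation f J) where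
  carrier := {z | (z : A × B).1 ∈ 𝔭}
  zero_mem' := by simp
  add_mem' := fun {a b} ha hb => 𝔭.add_mem ha hb
  smul_mem' := fun c {z} hz => 𝔭.mul_mem_left (c : A × B).1 hz

/-- The ideal `𝔮̄^f = {(a, f a + j) : a ∈ A, j ∈ J, f a + j ∈ 𝔮}` of `A ⋈^f J`. -/
def qbarAmalg {A B : Type*} [CommRing A] [CommRing B] (f : A →+* B) (J : Ideal B)
    (𝔮 : Ideal B) : Ideal ↥(amalgamation f J) where
  carrier := {z | (z : A × B).2 ∈ 𝔮}
  zero_mem' := by simp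
  add_mem' := fun {a b} ha hb => 𝔮.add_mem ha hb
  smul_mem' := fun c {z} hz => 𝔮.mul_mem_left (c : A × B).2 hz

/-- A ring homomorphism `f : A →+* B` satisfies the going-down property. -/
def RingHom.GoesDown {A B : Type*} [CommRing A] [CommRing B] (f : A →+* B) : Prop :=
  ∀ (𝔭' 𝔭 : Ideal A), 𝔭'.IsPrime → 𝔭.IsPrime → 𝔭' ≤ 𝔭 →
    ∀ 𝔮 : Ideal B, 𝔮.IsPrime → 𝔮.comap f = 𝔭 →
      ∃ 𝔮' : Ideal B, 𝔮'.IsPrime ∧ 𝔮' ≤ 𝔮 ∧ 𝔮'.comap f = 𝔭'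

section PrimesBelow

variable {R : Type*} [CommRing R]

/-- If `a` lies in every prime between `K` and `p`, then `a` is in the radical of `K`
locally at `p`. -/
lemma Ideal.exists_notMem_mul_pow_mem (p : Ideal R) [p.IsPrime] (K : Ideal R) (a : R)
    (H : ∀ q : Ideal R, q.IsPrime → K ≤ q → q ≤ p → a ∈ q) :
    ∃ s ∉ p, ∃ m : ℕ, s * a ^ m ∈ K := by
  by_contra! hcon
  obtain ⟨q, hq, hKq, hdisj⟩ := Ideal.exists_le_prime_disjoint K
    (p.primeCompl ⊔ Submonoid.powers a) (by
      rw [Set.disjoint_left]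
      rintro z hz hz'
      obtain ⟨s, hs, t, ⟨m, rfl⟩, rfl⟩ := Submonoid.mem_sup.1 hz'
      exact hcon s hs m hz)
  rw [Set.disjoint_left] at hdisj
  refine hdisj (H q hq hKq fun z hz => ?_)
    ((le_sup_right : Submonoid.powers a ≤ _) (Submonoid.mem_powers a))
  by_contra hzp
  exact hdisj hz ((le_sup_left : p.primeCompl ≤ _) hzp)

/-- The boundary ideal of `b` relative to `I`, generated by `b` and `(√I : b)`. -/
def boundaryIdeal (I : Ideal R) (b : R) : Ideal R :=
  Ideal.span {b} ⊔ Submodule.comap (LinearMap.mulLeft R b) I.radical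

lemma le_boundaryIdeal (I : Ideal R) (b : R) : I ≤ boundaryIdeal I b :=
  fun _ hz => (le_sup_right : _ ≤ boundaryIdeal I b)
    (I.radical.mul_mem_left b (Ideal.le_radical hz))

lemma not_boundaryIdeal_le_of_mem_minimalPrimes {I q : Ideal R} (hq : q ∈ I.minimalPrimes)
    (b : R) : ¬ boundaryIdeal I b ≤ q := by
  intro hle
  have := hq.1.1
  have hb : b ∈ q := hle ((le_sup_left : _ ≤ boundaryIdeal I b) (Ideal.mem_span_singleton_self b))
  obtain ⟨s, hs, m, hm⟩ := q.exists_notMem_mul_pow_mem I b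
    fun q' hq' hI hle' => hq.2 ⟨hq', hI⟩ hle' hb
  refine hs (hle ((le_sup_right : _ ≤ boundaryIdeal I b) ?_))
  refine ⟨m + 1, ?_⟩
  have : (LinearMap.mulLeft R b s) ^ (m + 1) = (s * b ^ m) * (s ^ m * b) := by
    simp only [LinearMap.mulLeft_apply]; ring
  rw [this]
  exact I.mul_mem_right _ hm

/-- All chains of primes between `I` and `p` have length at most `h`. -/
def ChainLengthLE (p : PrimeSpectrum R) (I : Ideal R) (h : ℕ) : Prop :=
  ∀ l : LTSeries (PrimeSpectrum R), I ≤ l.head.asIdeal → l.last ≤ p → l.length ≤ h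

lemma ChainLengthLE.boundaryIdeal {p : PrimeSpectrum R} {I : Ideal R} {h : ℕ}
    (H : ChainLengthLE p I (h + 1)) (b : R) : ChainLengthLE p (boundaryIdeal I b) h := by
  intro l hl hlp
  have := l.head.isPrime
  obtain ⟨q, hq, hqle⟩ := Ideal.exists_minimalPrimes_le ((le_boundaryIdeal I b).trans hl)
  have hlt : (⟨q, hq.1.1⟩ : PrimeSpectrum R) < l.head := by
    refine lt_of_le_of_ne hqle fun h => ?_
    refine not_boundaryIdeal_le_of_mem_minimalPrimes hq b ?_
    rw [← h] at hl
    exact hl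
  have := H (l.cons ⟨q, hq.1.1⟩ hlt) (by simpa using hq.1.2) (by simpa using hlp)
  simpa using this

/-- A local form of Kronecker's theorem. -/
lemma exists_mem_of_forall_add_mul_mem (p : PrimeSpectrum R) {a : R} (ha : a ∈ p.asIdeal)
    (h : ℕ) : ∀ (I : Ideal R), ChainLengthLE p I h → ∀ b : Fin h → R, ∃ c : Fin h → R,
      ∀ q : Ideal R, q.IsPrime → I ≤ q → q ≤ p.asIdeal → (∀ i, b i + a * c i ∈ q) → a ∈ q := by
  induction h with
  | zero =>
    intro I hI b
    refine ⟨0, fun q hq hIq hqp _ => ?_⟩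
    by_contra haq
    have hlt : (⟨q, hq⟩ : PrimeSpectrum R) < p :=
      lt_of_le_of_ne hqp fun h => haq (by rw [← h] at ha; exact ha)
    let l : LTSeries (PrimeSpectrum R) := RelSeries.singleton _ p
    exact Nat.not_succ_le_zero 0 (hI (l.cons ⟨q, hq⟩ hlt) hIq le_rfl)
  | succ h ih =>
    intro I hI b
    obtain ⟨c, hc⟩ := ih (boundaryIdeal I (b 0)) (hI.boundaryIdeal (b 0)) (fun i => b i.succ)
    obtain ⟨s, hs, m, hm⟩ := p.asIdeal.exists_notMem_mul_pow_mem
      (boundaryIdeal I (b 0) ⊔ Ideal.span (Set.range fun i => b i.succ + a * c i)) a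
      fun q hq hKq hqp => hc q hq (le_sup_left.trans hKq) hqp
        fun i => hKq (Ideal.mem_sup_right (Ideal.subset_span ⟨i, rfl⟩))
    obtain ⟨u, hu, v, hv, huv⟩ := Submodule.mem_sup.1 hm
    obtain ⟨r, hr, y, hy, hry⟩ := Submodule.mem_sup.1 hu
    refine ⟨Fin.cons y c, fun q hq hIq hqp hbc => ?_⟩
    have h0 : b 0 + a * y ∈ q := by simpa using hbc 0
    have hby : b 0 * y ∈ q := hq.radical_le_iff.2 hIq hy
    have hb : b 0 ∈ q := by
      have : b 0 ^ 2 ∈ q := by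
        have h1 : b 0 ^ 2 = b 0 * (b 0 + a * y) - a * (b 0 * y) := by ring
        rw [h1]
        exact q.sub_mem (q.mul_mem_left _ h0) (q.mul_mem_left _ hby)
      exact hq.mem_of_pow_mem 2 this
    have hay : a * y ∈ q := by simpa using q.sub_mem h0 hb
    have hv' : v ∈ q := by
      refine (Ideal.span_le.2 ?_ : Ideal.span _ ≤ q) hv
      rintro _ ⟨i, rfl⟩
      simpa using hbc i.succ
    have hr' : r ∈ q := (Ideal.span_singleton_le_iff_mem q).2 hb hr
    have key : s * a ^ (m + 1) ∈ q := by
      have : s * a ^ (m + 1) = a * r + a * y + a * v := by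
        rw [pow_succ, ← mul_assoc, ← huv, ← hry]; ring
      rw [this]
      exact q.add_mem (q.add_mem (q.mul_mem_left _ hr') hay) (q.mul_mem_left _ hv')
    exact hq.mem_of_pow_mem _ ((hq.mem_or_mem key).resolve_left fun hsq => hs (hqp hsq))

/-- In a local ring of dimension at most `h`, every finitely generated proper ideal is generated
up to radical by `h` elements. -/
lemma exists_fin_height_generators (p : PrimeSpectrum R) {h : ℕ} (hp : Order.height p ≤ h)
    {n : ℕ} (x : Fin n → R) (hx : ∀ i, x i ∈ p.asIdeal) :
    ∃ y : Fin h → R, (∀ i, y i ∈ p.asIdeal) ∧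
      ∀ q : Ideal R, q.IsPrime → q ≤ p.asIdeal → (∀ i, y i ∈ q) → ∀ i, x i ∈ q := by
  induction n with
  | zero => exact ⟨0, fun i => p.asIdeal.zero_mem, fun _ _ _ _ i => i.elim0⟩
  | succ n ih =>
    obtain ⟨b, hb, hbx⟩ := ih (fun i => x i.succ) (fun i => hx i.succ)
    obtain ⟨c, hc⟩ := exists_mem_of_forall_add_mul_mem p (hx 0) h ⊥
      (fun l _ hl => by exact_mod_cast (Order.length_le_height hl).trans hp) b
    refine ⟨fun i => b i + x 0 * c i,
      fun i => p.asIdeal.add_mem (hb i) (p.asIdeal.mul_mem_right _ (hx 0)),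
      fun q hq hqp hy => ?_⟩
    have h0 := hc q hq bot_le hqp hy
    refine Fin.cases h0 (hbx q hq hqp fun i => ?_)
    exact (Ideal.add_mem_iff_left q (q.mul_mem_right _ h0)).1 (hy i)

end PrimesBelow

section Koszul

variable {R : Type*} [CommRing R] {M : Type*} [AddCommGroup M] [Module R M]
variable {ι : Type*} [LinearOrder ι]

/-- The Koszul differential on `M`-valued functions on all finite subsets of `ι`. -/
def koszulD (x : ι → R) (g : Finset ι → M) (t : Finset ι) : M :=
  ∑ j ∈ t, ((-1) ^ (t.filter (fun k => k < j)).card * x j) • g (t.erase j)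

/-- Vanishing of the `i`-th Koszul cohomology of the subfamily of `x` indexed by `S`. -/
def KoszulVanishes (x : ι → R) (M : Type*) [AddCommGroup M] [Module R M]
    (S : Finset ι) (i : ℕ) : Prop :=
  ∀ g : Finset ι → M, (∀ t ⊆ S, t.card = i + 1 → koszulD x g t = 0) →
    ∃ h : Finset ι → M, ∀ s ⊆ S, s.card = i → g s = koszulD x h s

/-- The sign of inserting `a` into `t`. -/
def insertSign (R : Type*) [CommRing R] (a : ι) (t : Finset ι) : R :=
  (-1) ^ (t.filter (fun k => k < a)).card

lemma insertSign_mul_self (a : ι) (t : Finset ι) :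
    insertSign R a t * insertSign R a t = 1 := by
  rw [insertSign, ← pow_add, Even.neg_one_pow ⟨_, rfl⟩]

lemma insertSign_smul_smul (a : ι) (t : Finset ι) (m : M) :
    insertSign R a t • insertSign R a t • m = m := by
  rw [smul_smul, insertSign_mul_self, one_smul]

lemma koszulD_congr (x : ι → R) {g g' : Finset ι → M} {t : Finset ι}
    (H : ∀ j ∈ t, g (t.erase j) = g' (t.erase j)) : koszulD x g t = koszulD x g' t :=
  Finset.sum_congr rfl fun j hj => by rw [H j hj]

lemma koszulD_add (x : ι → R) (g g' : Finset ι → M) (t : Finset ι) :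
    koszulD x (fun s => g s + g' s) t = koszulD x g t + koszulD x g' t := by
  simp [koszulD, Finset.sum_add_distrib]

lemma koszulD_smul (x : ι → R) (r : R) (g : Finset ι → M) (t : Finset ι) :
    koszulD x (fun s => r • g s) t = r • koszulD x g t := by
  simp only [koszulD, Finset.smul_sum]
  exact Finset.sum_congr rfl fun j _ => smul_comm _ _ _

lemma koszulD_sub (x : ι → R) (g g' : Finset ι → M) (t : Finset ι) :
    koszulD x (fun s => g s - g' s) t = koszulD x g t - koszulD x g' t := by
  simp [koszulD, Finset.sum_sub_distrib, smul_sub]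

lemma koszulD_zero (x : ι → R) (t : Finset ι) : koszulD x (fun _ => (0 : M)) t = 0 := by
  simp [koszulD]

lemma koszulD_map {R' N : Type*} [CommRing R'] [AddCommGroup N] [Module R' N] (φ : M →+ N)
    {x : ι → R} {x' : ι → R'} (hφ : ∀ j m, φ (x j • m) = x' j • φ m) (g : Finset ι → M)
    (t : Finset ι) : φ (koszulD x g t) = koszulD x' (fun s => φ (g s)) t := by
  simp only [koszulD, map_sum]
  refine Finset.sum_congr rfl fun j _ => ?_
  rcases neg_one_pow_eq_or R (t.filter (fun k => k < j)).card with h | h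
  all_goals
    rcases Nat.even_or_odd (t.filter (fun k => k < j)).card with h' | h'
    · simp [h'.neg_one_pow, hφ]
    · simp [h'.neg_one_pow, hφ]

lemma koszulD_comp {κ : Type*} [LinearOrder κ] (e : ι ↪o κ) (x : κ → R) (g : Finset κ → M)
    (t : Finset ι) :
    koszulD x g (t.map e.toEmbedding) =
      koszulD (fun i => x (e i)) (fun s => g (s.map e.toEmbedding)) t := by
  simp only [koszulD, Finset.sum_map, Finset.map_erase, Finset.filter_map, Finset.card_map]
  refine Finset.sum_congr rfl fun j _ => ?_
  congr 4
  ext k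
  simp

lemma KoszulVanishes.map_iff {κ : Type*} [LinearOrder κ] (e : ι ↪o κ) (x : κ → R)
    (S : Finset ι) (i : ℕ) :
    KoszulVanishes x M (S.map e.toEmbedding) i ↔ KoszulVanishes (fun i => x (e i)) M S i := by
  have key (h : Finset ι → M) :
      ∃ h' : Finset κ → M, (fun s : Finset ι => h' (s.map e.toEmbedding)) = h :=
    ⟨Function.extend (Finset.map e.toEmbedding) h 0,
      funext fun s => (Finset.map_injective e.toEmbedding).extend_apply _ _ _⟩
  constructor
  · intro H g hg
    obtain ⟨g, rfl⟩ := key g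
    obtain ⟨h, hh⟩ := H g fun t ht hc => by
      obtain ⟨u, hu, rfl⟩ := Finset.subset_map_iff.1 ht
      rw [koszulD_comp]
      exact hg u hu (by simpa using hc)
    refine ⟨fun s => h (s.map e.toEmbedding), fun s hs hc => ?_⟩
    rw [← koszulD_comp]
    exact hh _ (Finset.map_subset_map.2 hs) (by simpa using hc)
  · intro H g hg
    obtain ⟨h, hh⟩ := H (fun s => g (s.map e.toEmbedding)) fun t ht hc => by
      rw [← koszulD_comp]
      exact hg _ (Finset.map_subset_map.2 ht) (by simpa using hc)
    obtain ⟨h, rfl⟩ := key h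
    refine ⟨h, fun s hs hc => ?_⟩
    obtain ⟨u, hu, rfl⟩ := Finset.subset_map_iff.1 hs
    rw [koszulD_comp]
    exact hh u hu (by simpa using hc)

lemma insertSign_erase_mul {a j : ι} {t : Finset ι} (ha : a ∉ t) (hj : j ∈ t) :
    (-1 : R) ^ ((insert a t).filter (fun k => k < j)).card =
      -(insertSign R a t * (-1) ^ (t.filter (fun k => k < j)).card *
        insertSign R a (t.erase j)) := by
  have hne : j ≠ a := fun h => ha (h ▸ hj)
  unfold insertSign
  rcases lt_or_gt_of_ne hne with hlt | hlt
  · have h1 : (insert a t).filter (fun k => k < j) = t.filter (fun k => k < j) := by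
      rw [Finset.filter_insert, if_neg hlt.not_gt]
    have h2 : (t.filter (fun k => k < a)).card = ((t.erase j).filter (fun k => k < a)).card + 1 := by
      rw [Finset.filter_erase, Finset.card_erase_add_one (by simp [hj, hlt])]
    rw [h1, h2, pow_succ, mul_assoc, mul_comm _ ((-1) ^ ((t.erase j).filter _).card), ← mul_assoc]
    have := insertSign_mul_self (R := R) a (t.erase j)
    unfold insertSign at this
    linear_combination (-(-1 : R) ^ (t.filter (fun k => k < j)).card) * this
  · have h1 : ((insert a t).filter (fun k => k < j)).card =
        (t.filter (fun k => k < j)).card + 1 := by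
      rw [Finset.filter_insert, if_pos hlt, Finset.card_insert_of_notMem (by simp [ha])]
    have h2 : (t.erase j).filter (fun k => k < a) = t.filter (fun k => k < a) := by
      rw [Finset.filter_erase, Finset.erase_eq_of_notMem (by simp [hlt.le])]
    rw [h1, h2, pow_succ]
    have := insertSign_mul_self (R := R) a t
    unfold insertSign at this
    linear_combination ((-1 : R) ^ (t.filter (fun k => k < j)).card) * this

lemma koszulD_insert (x : ι → R) (g : Finset ι → M) {a : ι} {t : Finset ι} (ha : a ∉ t) :
    koszulD x g (insert a t) = insertSign R a t •
      (x a • g t - koszulD x (fun s => insertSign R a s • g (insert a s)) t) := by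
  rw [koszulD, Finset.sum_insert ha, smul_sub, sub_eq_add_neg]
  congr 1
  · rw [Finset.erase_insert ha, Finset.filter_insert, if_neg (lt_irrefl a), mul_smul]
    rfl
  · rw [koszulD, Finset.smul_sum, ← Finset.sum_neg_distrib]
    refine Finset.sum_congr rfl fun j hj => ?_
    have hne : a ≠ j := fun h => ha (h ▸ hj)
    rw [insertSign_erase_mul ha hj, Finset.erase_insert_of_ne hne, smul_smul, smul_smul,
      ← neg_smul]
    congr 1
    ring

/-- The cochain whose parts without and with `a` are `g₀` and `g₁`. -/
def koszulGlue (R : Type*) [CommRing R] [Module R M] (a : ι) (g₀ g₁ : Finset ι → M)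
    (t : Finset ι) : M :=
  if a ∈ t then insertSign R a (t.erase a) • g₁ (t.erase a) else g₀ t

lemma koszulGlue_of_notMem {a : ι} (g₀ g₁ : Finset ι → M) {t : Finset ι} (ha : a ∉ t) :
    koszulGlue R a g₀ g₁ t = g₀ t := if_neg ha

lemma koszulGlue_insert {a : ι} (g₀ g₁ : Finset ι → M) {t : Finset ι} (ha : a ∉ t) :
    koszulGlue R a g₀ g₁ (insert a t) = insertSign R a t • g₁ t := by
  rw [koszulGlue, if_pos (Finset.mem_insert_self a t), Finset.erase_insert ha]

lemma koszulD_koszulGlue (x : ι → R) {a : ι} (g₀ g₁ : Finset ι → M) {t : Finset ι}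
    (ha : a ∉ t) : koszulD x (koszulGlue R a g₀ g₁) t = koszulD x g₀ t :=
  koszulD_congr x fun _ _ => koszulGlue_of_notMem _ _ fun h => ha (Finset.mem_of_mem_erase h)

lemma koszulD_koszulGlue_insert (x : ι → R) {a : ι} (g₀ g₁ : Finset ι → M) {t : Finset ι}
    (ha : a ∉ t) : koszulD x (koszulGlue R a g₀ g₁) (insert a t) =
      insertSign R a t • (x a • g₀ t - koszulD x g₁ t) := by
  rw [koszulD_insert x _ ha, koszulGlue_of_notMem _ _ ha]
  congr 2
  refine koszulD_congr x fun j _ => ?_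
  rw [koszulGlue_insert _ _ fun h => ha (Finset.mem_of_mem_erase h), insertSign_smul_smul]

lemma subset_of_subset_insert_of_notMem {a : ι} {S t : Finset ι} (ht : t ⊆ insert a S)
    (ha : a ∉ t) : t ⊆ S := (Finset.subset_insert_iff_of_notMem ha).1 ht

lemma KoszulVanishes.insert_zero {x : ι → R} {S : Finset ι} {a : ι} (H : KoszulVanishes x M S 0) :
    KoszulVanishes x M (insert a S) 0 := by
  intro g hg
  obtain ⟨h, hh⟩ := H g fun t ht => hg t (ht.trans (Finset.subset_insert a S))
  refine ⟨h, fun s _ hc => ?_⟩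
  rw [Finset.card_eq_zero.1 hc]
  exact hh ∅ (Finset.empty_subset S) rfl

lemma KoszulVanishes.insert_succ {x : ι → R} {S : Finset ι} {a : ι} {i : ℕ} (ha : a ∉ S)
    (H : KoszulVanishes x M S i) (H' : KoszulVanishes x M S (i + 1)) :
    KoszulVanishes x M (insert a S) (i + 1) := by
  intro g hg
  obtain ⟨h₀, hh₀⟩ := H' g fun t ht => hg t (ht.trans (Finset.subset_insert a S))
  set g₁ : Finset ι → M := fun s => insertSign R a s • g (insert a s) with hg₁
  obtain ⟨h₁, hh₁⟩ := H (fun s => x a • h₀ s - g₁ s) fun t ht hc => by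
    have hat : a ∉ t := fun h => ha (ht h)
    have := hg (insert a t) (Finset.insert_subset_insert a ht)
      (by rw [Finset.card_insert_of_notMem hat, hc])
    rw [koszulD_insert x g hat] at this
    have h2 := congrArg (insertSign R a t • ·) this
    simp only [insertSign_smul_smul, smul_zero] at h2
    rw [koszulD_sub, koszulD_smul, ← hh₀ t ht hc, h2]
  refine ⟨koszulGlue R a h₀ h₁, fun s hs hc => ?_⟩
  by_cases has : a ∈ s
  · obtain ⟨t, hat, rfl⟩ : ∃ t, a ∉ t ∧ insert a t = s :=
      ⟨s.erase a, s.notMem_erase a, Finset.insert_erase has⟩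
    rw [Finset.card_insert_of_notMem hat, Nat.add_right_cancel_iff] at hc
    have hts : t ⊆ S :=
      subset_of_subset_insert_of_notMem ((Finset.subset_insert a t).trans hs) hat
    rw [koszulD_koszulGlue_insert x _ _ hat, ← hh₁ t hts hc, sub_sub_cancel, hg₁,
      insertSign_smul_smul]
  · rw [koszulD_koszulGlue x _ _ has]
    exact hh₀ s (subset_of_subset_insert_of_notMem hs has) hc

lemma KoszulVanishes.union {x : ι → R} {S : Finset ι} {k : ℕ}
    (H : ∀ i ≤ k, KoszulVanishes x M S i) (T : Finset ι) :
    ∀ i ≤ k, KoszulVanishes x M (T ∪ S) i := by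
  induction T using Finset.induction_on with
  | empty => simpa using H
  | insert a T _ ih =>
    intro i hi
    rw [Finset.insert_union]
    by_cases ha : a ∈ T ∪ S
    · rw [Finset.insert_eq_of_mem ha]
      exact ih i hi
    · cases i with
      | zero => exact (ih 0 hi).insert_zero
      | succ i => exact KoszulVanishes.insert_succ ha (ih i (by omega)) (ih (i + 1) hi)

/-- The ideal generated by a sequence annihilates its Koszul cohomology. -/
lemma exists_smul_eq_koszulD (x : ι → R) {S : Finset ι} {i : ℕ} {g : Finset ι → M}
    (hg : ∀ t ⊆ S, t.card = i + 1 → koszulD x g t = 0) {e : R}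
    (he : e ∈ Ideal.span (x '' S)) :
    ∃ h : Finset ι → M, ∀ s ⊆ S, s.card = i → e • g s = koszulD x h s := by
  induction he using Submodule.span_induction with
  | mem y hy =>
    obtain ⟨a, ha, rfl⟩ := hy
    refine ⟨koszulGlue R a (fun s => insertSign R a s • g (insert a s)) fun _ => 0,
      fun s hs hc => ?_⟩
    by_cases has : a ∈ s
    · obtain ⟨t, hat, rfl⟩ : ∃ t, a ∉ t ∧ insert a t = s :=
        ⟨s.erase a, s.notMem_erase a, Finset.insert_erase has⟩
      rw [koszulD_koszulGlue_insert x _ _ hat, koszulD_zero, sub_zero, smul_comm (x a),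
        insertSign_smul_smul]
    · rw [koszulD_koszulGlue x _ _ has]
      have := hg (insert a s) (Finset.insert_subset ha hs)
        (by rw [Finset.card_insert_of_notMem has, hc])
      rw [koszulD_insert x g has] at this
      have h2 := congrArg (insertSign R a s • ·) this
      simp only [insertSign_smul_smul, smul_zero] at h2
      exact sub_eq_zero.1 h2
  | zero => exact ⟨fun _ => 0, fun s _ _ => by rw [koszulD_zero, zero_smul]⟩
  | add y z _ _ hy hz =>
    obtain ⟨h, hh⟩ := hy
    obtain ⟨h', hh'⟩ := hz
    exact ⟨fun s => h s + h' s, fun s hs hc => by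
      rw [koszulD_add, add_smul, hh s hs hc, hh' s hs hc]⟩
  | smul r y _ hy =>
    obtain ⟨h, hh⟩ := hy
    exact ⟨fun s => r • h s, fun s hs hc => by
      rw [koszulD_smul, smul_assoc, hh s hs hc]⟩

lemma KoszulVanishes.of_insert {x : ι → R} {S : Finset ι} {a : ι} {i : ℕ} (ha : a ∉ S)
    (hrad : x a ∈ (Ideal.span (x '' S)).radical) (H : KoszulVanishes x M (insert a S) i) :
    KoszulVanishes x M S i := by
  intro g hg
  obtain ⟨N, hN⟩ := hrad
  obtain ⟨h, hh⟩ := exists_smul_eq_koszulD x hg hN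
  clear hN
  induction N generalizing h with
  | zero => exact ⟨h, fun s hs hc => by simpa using hh s hs hc⟩
  | succ N ih =>
    obtain ⟨h', hh'⟩ := H (koszulGlue R a (fun s => x a ^ N • g s) h) fun t ht hc => by
      by_cases hat : a ∈ t
      · obtain ⟨u, hau, rfl⟩ : ∃ u, a ∉ u ∧ insert a u = t :=
          ⟨t.erase a, t.notMem_erase a, Finset.insert_erase hat⟩
        rw [Finset.card_insert_of_notMem hau, Nat.add_right_cancel_iff] at hc
        have hu : u ⊆ S :=
          subset_of_subset_insert_of_notMem ((Finset.subset_insert a u).trans ht) hau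
        rw [koszulD_koszulGlue_insert x _ _ hau, ← hh u hu hc, smul_smul, ← pow_succ', sub_self,
          smul_zero]
      · rw [koszulD_koszulGlue x _ _ hat, koszulD_smul,
          hg t (subset_of_subset_insert_of_notMem ht hat) hc, smul_zero]
    refine ih h' fun s hs hc => ?_
    have has : a ∉ s := fun h => ha (hs h)
    rw [← hh' s (hs.trans (Finset.subset_insert a S)) hc, koszulGlue_of_notMem _ _ has]

lemma KoszulVanishes.of_union {x : ι → R} {S T : Finset ι} {i : ℕ}
    (hrad : ∀ a ∈ T, x a ∈ (Ideal.span (x '' S)).radical)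
    (H : KoszulVanishes x M (T ∪ S) i) : KoszulVanishes x M S i := by
  induction T using Finset.induction_on with
  | empty => simpa using H
  | insert a T _ ih =>
    refine ih (fun b hb => hrad b (Finset.mem_insert_of_mem hb)) ?_
    rw [Finset.insert_union] at H
    by_cases ha : a ∈ T ∪ S
    · rwa [Finset.insert_eq_of_mem ha] at H
    · refine H.of_insert ha (Ideal.radical_mono (Ideal.span_mono (Set.image_mono ?_))
        (hrad a (Finset.mem_insert_self a T)))
      exact_mod_cast Finset.subset_union_right

lemma KoszulVanishes.mono {x : ι → R} {S T : Finset ι} {k : ℕ} (hST : S ⊆ T)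
    (H : ∀ i ≤ k, KoszulVanishes x M S i) : ∀ i ≤ k, KoszulVanishes x M T i := by
  rw [← Finset.union_eq_left.2 hST]
  exact KoszulVanishes.union H T

lemma KoszulVanishes.of_subset {x : ι → R} {S T : Finset ι} {i : ℕ} (hST : S ⊆ T)
    (hrad : ∀ a ∈ T, x a ∈ (Ideal.span (x '' S)).radical) (H : KoszulVanishes x M T i) :
    KoszulVanishes x M S i :=
  KoszulVanishes.of_union hrad (by rwa [Finset.union_eq_left.2 hST])

lemma KoszulVanishes.append_left {n m k : ℕ} (x : Fin n → R) (y : Fin m → R)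
    (H : ∀ i ≤ k, KoszulVanishes x M Finset.univ i) :
    ∀ i ≤ k, KoszulVanishes (Fin.append x y) M Finset.univ i := by
  have h1 : ∀ i ≤ k, KoszulVanishes (Fin.append x y) M
      (Finset.univ.map (Fin.castAddOrderEmb m).toEmbedding) i := fun i hi => by
    rw [KoszulVanishes.map_iff]
    simpa using H i hi
  exact KoszulVanishes.mono (Finset.subset_univ _) h1

lemma KoszulVanishes.append_right {n m k : ℕ} (x : Fin n → R) (y : Fin m → R)
    (H : ∀ i ≤ k, KoszulVanishes y M Finset.univ i) :
    ∀ i ≤ k, KoszulVanishes (Fin.append x y) M Finset.univ i := by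
  have h1 : ∀ i ≤ k, KoszulVanishes (Fin.append x y) M
      (Finset.univ.map (Fin.natAddOrderEmb n).toEmbedding) i := fun i hi => by
    rw [KoszulVanishes.map_iff]
    simpa using H i hi
  exact KoszulVanishes.mono (Finset.subset_univ _) h1

lemma KoszulVanishes.of_append {n m i : ℕ} {x : Fin n → R} {y : Fin m → R}
    (hrad : ∀ j, x j ∈ (Ideal.span (Set.range y)).radical)
    (H : KoszulVanishes (Fin.append x y) M Finset.univ i) :
    KoszulVanishes y M Finset.univ i := by
  have himage : Fin.append x y '' ((Finset.univ.map (Fin.natAddOrderEmb n).toEmbedding :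
      Finset (Fin (n + m))) : Set (Fin (n + m))) = Set.range y := by
    rw [Finset.coe_map, Finset.coe_univ, Set.image_univ, ← Set.range_comp]
    exact congrArg Set.range (funext fun j => Fin.append_right x y j)
  have h1 : KoszulVanishes (Fin.append x y) M
      (Finset.univ.map (Fin.natAddOrderEmb n).toEmbedding) i := by
    refine H.of_subset (Finset.subset_univ _) fun a _ => ?_
    rw [himage]
    refine Fin.addCases (fun j => ?_) (fun j => ?_) a
    · simpa using hrad j
    · simpa using Ideal.le_radical (Ideal.subset_span (Set.mem_range_self j))
  rw [KoszulVanishes.map_iff] at h1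
  simpa using h1

lemma koszulMap_apply {n : ℕ} (x : Fin n → R) (i : ℕ) (g : Finset (Fin n) → M)
    (t : {s : Finset (Fin n) // s.card = i + 1}) :
    koszulMap R M x i (fun s => g s.1) t = koszulD x g t.1 :=
  Finset.sum_attach t.1
    fun j => ((-1) ^ (t.1.filter (fun k => k < j)).card * x j) • g (t.1.erase j)

lemma exists_restrict_eq {n i : ℕ} (g : {s : Finset (Fin n) // s.card = i} → M) :
    ∃ g' : Finset (Fin n) → M, (fun s : {s : Finset (Fin n) // s.card = i} => g' s.1) = g :=
  ⟨Function.extend Subtype.val g 0,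
    funext fun _ => Subtype.val_injective.extend_apply _ _ _⟩

lemma koszulCohomologyNeZero_iff {n : ℕ} (x : Fin n → R) (i : ℕ) :
    koszulCohomologyNeZero R M x i ↔ ¬ KoszulVanishes x M Finset.univ i := by
  have hker (i : ℕ) (g : Finset (Fin n) → M) :
      (fun s : {s : Finset (Fin n) // s.card = i} => g s.1) ∈ LinearMap.ker (koszulMap R M x i) ↔
        ∀ t ⊆ Finset.univ, t.card = i + 1 → koszulD x g t = 0 := by
    rw [LinearMap.mem_ker, funext_iff]
    simp [koszulMap_apply]
  cases i with
  | zero =>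
    rw [koszulCohomologyNeZero, ne_eq, not_iff_not, Submodule.eq_bot_iff]
    constructor
    · intro H g hg
      refine ⟨0, fun s _ hs => ?_⟩
      have h0 : g s = 0 := congrFun (H _ ((hker 0 g).2 hg)) ⟨s, hs⟩
      rw [h0, Finset.card_eq_zero.1 hs]
      simp [koszulD]
    · intro H g hg
      obtain ⟨g, rfl⟩ := exists_restrict_eq g
      obtain ⟨h, hh⟩ := H g ((hker 0 g).1 hg)
      funext s
      have := hh s.1 (Finset.subset_univ _) s.2
      rw [this, Finset.card_eq_zero.1 s.2]
      simp [koszulD]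
  | succ i =>
    rw [koszulCohomologyNeZero, not_iff_not]
    constructor
    · intro H g hg
      obtain ⟨h, hh⟩ := H ((hker (i + 1) g).2 hg)
      obtain ⟨h, rfl⟩ := exists_restrict_eq h
      refine ⟨h, fun s _ hs => ?_⟩
      have := congrFun hh ⟨s, hs⟩
      rw [koszulMap_apply] at this
      exact this.symm
    · intro H g hg
      obtain ⟨g, rfl⟩ := exists_restrict_eq g
      obtain ⟨h, hh⟩ := H g ((hker (i + 1) g).1 hg)
      refine ⟨fun s => h s.1, funext fun s => ?_⟩
      rw [koszulMap_apply]
      exact (hh s.1 (Finset.subset_univ _) s.2).symm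

lemma lt_kgrSeq_iff {n : ℕ} (x : Fin n → R) (k : ℕ) :
    (k : ℕ∞) < kgrSeq R M x ↔ ∀ i ≤ k, KoszulVanishes x M Finset.univ i := by
  rw [← ENat.add_one_le_iff (ENat.natCast_ne_top k), kgrSeq, le_sInf_iff]
  constructor
  · intro H i hi
    by_contra hcon
    have : ((k + 1 : ℕ) : ℕ∞) ≤ (i : ℕ) := by
      exact_mod_cast H i ⟨i, rfl, (koszulCohomologyNeZero_iff x i).2 hcon⟩
    have : k + 1 ≤ i := by exact_mod_cast this
    omega
  · rintro H _ ⟨i, rfl, hi⟩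
    by_contra hcon
    refine (koszulCohomologyNeZero_iff x i).1 hi (H i ?_)
    have : ((i : ℕ) : ℕ∞) < ((k + 1 : ℕ) : ℕ∞) := by exact_mod_cast not_le.1 hcon
    have : i < k + 1 := by exact_mod_cast this
    omega

lemma lt_kgr_iff (𝔞 : Ideal R) (k : ℕ) :
    (k : ℕ∞) < kgr R 𝔞 M ↔ ∃ (n : ℕ) (x : Fin n → R), (∀ j, x j ∈ 𝔞) ∧
      ∀ i ≤ k, KoszulVanishes x M Finset.univ i := by
  simp only [kgr, lt_iSup_iff, lt_kgrSeq_iff, exists_prop]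

/-- Koszul vanishing is preserved by localization. -/
lemma KoszulVanishes.localization {n i : ℕ} {x : Fin n → R} (W : Submonoid R)
    {L : Type*} [CommRing L] [Algebra R L] [IsLocalization W L]
    (H : KoszulVanishes x R Finset.univ i) :
    KoszulVanishes (fun j => algebraMap R L (x j)) L Finset.univ i := by
  intro g hg
  obtain ⟨b, hb⟩ := IsLocalization.exist_integer_multiples_of_finite W g
  choose g₀ hg₀ using hb
  have hmap (k : Finset (Fin n) → R) (t : Finset (Fin n)) :
      algebraMap R L (koszulD x k t) =
        koszulD (fun j => algebraMap R L (x j)) (fun s => algebraMap R L (k s)) t :=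
    koszulD_map (algebraMap R L).toAddMonoidHom (by simp) k t
  have hzero (t : Finset (Fin n)) : ∃ w : W, t.card = i + 1 → (w : R) * koszulD x g₀ t = 0 := by
    by_cases hc : t.card = i + 1
    · have : algebraMap R L (koszulD x g₀ t) = 0 := by
        rw [hmap]
        have : (fun s => algebraMap R L (g₀ s)) = fun s => algebraMap R L b • g s :=
          funext fun s => by rw [hg₀, Algebra.smul_def, smul_eq_mul]
        rw [this, koszulD_smul, hg t (Finset.subset_univ t) hc, smul_zero]
      obtain ⟨w, hw⟩ := (IsLocalization.map_eq_zero_iff W L _).1 this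
      exact ⟨w, fun _ => hw⟩
    · exact ⟨1, fun h => absurd h hc⟩
  choose w hw using hzero
  obtain ⟨h, hh⟩ := H (fun s => ((∏ t, w t : W) : R) • g₀ s) fun t _ hc => by
    rw [koszulD_smul, smul_eq_mul, ← Finset.mul_prod_erase _ _ (Finset.mem_univ t)]
    rw [Submonoid.coe_mul, mul_right_comm, hw t hc, zero_mul]
  obtain ⟨u, hu⟩ := IsLocalization.map_units L ((∏ t, w t) * b)
  refine ⟨fun s => (↑u⁻¹ : L) • algebraMap R L (h s), fun s hs hc => ?_⟩
  rw [koszulD_smul, ← hmap, ← hh s hs hc, smul_eq_mul, smul_eq_mul, map_mul, hg₀,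
    Algebra.smul_def, ← mul_assoc (algebraMap R L _), ← map_mul, ← Submonoid.coe_mul, ← hu,
    Units.inv_mul_cancel_left]

/-- The Koszul grade of an ideal is at most the height of any prime containing it. -/
lemma kgr_le_height (𝔟 : Ideal R) (p : PrimeSpectrum R) (hp : 𝔟 ≤ p.asIdeal) :
    kgr R 𝔟 R ≤ Order.height p := by
  by_contra! hlt
  obtain ⟨h, hh⟩ := ENat.ne_top_iff_exists.1 hlt.ne_top
  rw [← hh, lt_kgr_iff] at hlt
  obtain ⟨n, x, hx, H⟩ := hlt
  obtain ⟨y, hy, hyx⟩ := exists_fin_height_generators p hh.ge x fun i => hp (hx i)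
  let L := Localization.AtPrime p.asIdeal
  have H1 : ∀ i ≤ h, KoszulVanishes (fun j => algebraMap R L (x j)) L Finset.univ i :=
    fun i hi => (H i hi).localization p.asIdeal.primeCompl
  have H2 := KoszulVanishes.append_left _ (fun j => algebraMap R L (y j)) H1 h le_rfl
  have H3 : KoszulVanishes (fun j => algebraMap R L (y j)) L Finset.univ h := by
    refine H2.of_append fun j => ?_
    obtain ⟨s, hs, m, hm⟩ := p.asIdeal.exists_notMem_mul_pow_mem (Ideal.span (Set.range y)) (x j)
      fun q hq hyq hqp => hyx q hq hqp (fun i => hyq (Ideal.subset_span ⟨i, rfl⟩)) j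
    refine ⟨m, ?_⟩
    have h1 := Ideal.mem_map_of_mem (algebraMap R L) hm
    rw [Ideal.map_span, ← Set.range_comp, map_mul] at h1
    rw [← map_pow]
    exact (Ideal.unit_mul_mem_iff_mem _
      (IsLocalization.map_units L (⟨s, hs⟩ : p.asIdeal.primeCompl))).1 h1
  obtain ⟨g, hg⟩ := H3 (fun _ => 1) fun t _ hc => by
    have := t.card_le_univ
    simp only [Fintype.card_fin] at this
    omega
  have h1 := hg Finset.univ le_rfl (by simp)
  refine (Ideal.ne_top_iff_one _).1 (IsLocalRing.maximalIdeal.isMaximal L).ne_top ?_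
  rw [h1]
  refine Ideal.sum_mem _ fun j _ => ?_
  refine Ideal.mul_mem_right _ _ (Ideal.mul_mem_left _ _ ?_)
  exact (IsLocalization.AtPrime.to_map_mem_maximal_iff L p.asIdeal (y j)).2 (hy j)

end Koszul

/-- Contraction along an integral ring map does not decrease heights of ideals. -/
lemma idealHeight_le_idealHeight_comap {A R : Type*} [CommRing A] [CommRing R] (φ : A →+* R)
    (hφ : φ.IsIntegral) (𝔟 : Ideal R) : idealHeight R 𝔟 ≤ idealHeight A (𝔟.comap φ) := by
  algebraize [φ]
  refine le_iInf₂ fun p hp => ?_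
  obtain ⟨Q, hQ, hQp, hQc⟩ := Ideal.exists_ideal_over_prime_of_isIntegral p.asIdeal 𝔟 hp
  refine (iInf₂_le ⟨Q, hQp⟩ hQ).trans ?_
  have hmono : StrictMono (PrimeSpectrum.comap φ) := fun q q' h => by
    have := q.isPrime
    exact Ideal.IsIntegral.comap_lt_comap (R := A) h
  have := Order.height_le_height_apply_of_strictMono _ hmono ⟨Q, hQp⟩
  rwa [show PrimeSpectrum.comap φ ⟨Q, hQp⟩ = p from PrimeSpectrum.ext hQc] at this

section Amalgamation

variable {A B : Type*} [CommRing A] [CommRing B] (f : A →+* B) (J : Ideal B)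

lemma koszulVanishes_amalgamation {n i : ℕ} {w : Fin n → A}
    (HA : KoszulVanishes w A Finset.univ i)
    (HJ : letI : Module A J := Module.compHom J f; KoszulVanishes w J Finset.univ i) :
    KoszulVanishes (fun j => amalgIota f J (w j)) (amalgamation f J) Finset.univ i := by
  let _ : Module A J := Module.compHom J f
  have hsmul (a : A) (z : J) : ((a • z : J) : B) = f a * z := rfl
  let φ₁ : amalgamation f J →+ A :=
    ((RingHom.fst A B).comp (amalgamation f J).subtype).toAddMonoidHom
  let φ₂ : amalgamation f J →+ J :=
    { toFun := fun z => ⟨z.1.2 - f z.1.1, z.2⟩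
      map_zero' := by ext; simp
      map_add' := fun z z' => by ext; simp; ring }
  have hφ (z z' : amalgamation f J) (h1 : φ₁ z = φ₁ z') (h2 : φ₂ z = φ₂ z') : z = z' := by
    have h1' : z.1.1 = z'.1.1 := h1
    have h2' : z.1.2 - f z.1.1 = z'.1.2 - f z'.1.1 := congrArg Subtype.val h2
    rw [h1', sub_left_inj] at h2'
    exact Subtype.ext (Prod.ext h1' h2')
  have hD₁ (g : Finset (Fin n) → amalgamation f J) (t : Finset (Fin n)) :
      φ₁ (koszulD (fun j => amalgIota f J (w j)) g t) = koszulD w (fun s => φ₁ (g s)) t :=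
    koszulD_map φ₁ (fun _ _ => rfl) g t
  have hD₂ (g : Finset (Fin n) → amalgamation f J) (t : Finset (Fin n)) :
      φ₂ (koszulD (fun j => amalgIota f J (w j)) g t) = koszulD w (fun s => φ₂ (g s)) t := by
    refine koszulD_map φ₂ (fun j m => Subtype.ext ?_) g t
    rw [hsmul]
    change f (w j) * m.1.2 - f (w j * m.1.1) = f (w j) * (m.1.2 - f m.1.1)
    rw [map_mul, mul_sub]
  intro g hg
  obtain ⟨h₁, hh₁⟩ := HA (fun s => φ₁ (g s)) fun t ht hc => by
    rw [← hD₁, hg t ht hc, map_zero]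
  obtain ⟨h₂, hh₂⟩ := HJ (fun s => φ₂ (g s)) fun t ht hc => by
    rw [← hD₂, hg t ht hc, map_zero]
  let h : Finset (Fin n) → amalgamation f J := fun s =>
    ⟨(h₁ s, f (h₁ s) + h₂ s), by
      change f (h₁ s) + h₂ s - f (h₁ s) ∈ J
      simp⟩
  have e₁ : (fun s => φ₁ (h s)) = h₁ := rfl
  have e₂ : (fun s => φ₂ (h s)) = h₂ := funext fun s => Subtype.ext (add_sub_cancel_left _ _)
  refine ⟨h, fun s hs hc => hφ _ _ ?_ ?_⟩
  · rw [hD₁, e₁]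
    exact hh₁ s hs hc
  · rw [hD₂, e₂]
    exact hh₂ s hs hc

lemma lt_kgr_amalgamation {𝔟 : Ideal (amalgamation f J)} {k : ℕ}
    (hA : (k : ℕ∞) < kgr A (𝔟.comap (amalgIota f J)) A)
    (hJ : (k : ℕ∞) < kgrIdeal f J (𝔟.comap (amalgIota f J))) :
    (k : ℕ∞) < kgr (amalgamation f J) 𝔟 (amalgamation f J) := by
  let _ : Module A J := Module.compHom J f
  obtain ⟨n, x, hx, Hx⟩ := (lt_kgr_iff _ k).1 hA
  obtain ⟨m, y, hy, Hy⟩ := (lt_kgr_iff (M := J) _ k).1 hJ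
  refine (lt_kgr_iff _ k).2 ⟨n + m, fun j => amalgIota f J (Fin.append x y j), fun j => ?_,
    fun i hi => koszulVanishes_amalgamation f J (KoszulVanishes.append_left x y Hx i hi)
      (KoszulVanishes.append_right x y Hy i hi)⟩
  refine Fin.addCases (fun j => ?_) (fun j => ?_) j
  · simpa using hx j
  · simpa using hy j

end Amalgamation

/-- Assume `ι_A : A → A⋈^f J` is an integral ring extension. If `A` is
Cohen-Macaulay in the sense of ideals and `kgr_A(𝔞, J) ≥ height 𝔞` for every ideal `𝔞`
of `A`, then `A⋈^f J` is Cohen-Macaulay in the sense of ideals. -/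
theorem isCMIdeals_amalgamation_of_isIntegral {A B : Type*} [CommRing A] [CommRing B]
    (f : A →+* B) (J : Ideal B) (hint : (amalgIota f J).IsIntegral)
    (hA : IsCMIdeals A)
    (hJ : ∀ 𝔞 : Ideal A, idealHeight A 𝔞 ≤ kgrIdeal f J 𝔞) :
    IsCMIdeals ↥(amalgamation f J) := by
  intro 𝔟
  refine le_antisymm ?_ (le_iInf₂ fun p hp => kgr_le_height 𝔟 p hp)
  by_contra! hlt
  obtain ⟨k, hk⟩ := ENat.ne_top_iff_exists.1 hlt.ne_top
  rw [← hk] at hlt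
  have hk' := hlt.trans_le (idealHeight_le_idealHeight_comap _ hint 𝔟)
  exact (lt_kgr_amalgamation f J (hk'.trans_eq (hA _)) (hk'.trans_le (hJ _))).ne hk
end

section
/- Let A be a commutative ring and J an ideal of A. Then the amalgamated duplication A⋈J is Cohen-Macaulay in the sense of ideals if and only if A is Cohen-Macaulay in the sense of ideals and kgr_A(𝔞, J) ≥ height 𝔞 for every ideal 𝔞 of A. -/
namespace Koszul

open Finset

section Differential

variable {A : Type*} [CommRing A] (M : Type*) [AddCommGroup M] [Module A M]

/-- The Koszul differential on all `M`-valued functions on subsets of `Fin n` at once. -/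
def diff {n : ℕ} (x : Fin n → A) : (Finset (Fin n) → M) →ₗ[A] (Finset (Fin n) → M) where
  toFun g t := ∑ j ∈ t, ((-1 : A) ^ #{k ∈ t | k < j} * x j) • g (t.erase j)
  map_add' g h := by
    funext t
    simp [smul_add, sum_add_distrib]
  map_smul' a g := by
    funext t
    simp only [Pi.smul_apply, RingHom.id_apply, smul_sum]
    exact sum_congr rfl fun j _ => smul_comm _ _ _

variable {M}

theorem diff_apply {n : ℕ} (x : Fin n → A) (g : Finset (Fin n) → M) (t : Finset (Fin n)) :
    diff M x g t = ∑ j ∈ t, ((-1 : A) ^ #{k ∈ t | k < j} * x j) • g (t.erase j) := rfl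

theorem diff_empty {n : ℕ} (x : Fin n → A) (g : Finset (Fin n) → M) : diff M x g ∅ = 0 := by
  simp [diff_apply]

theorem diff_comp {N : Type*} [AddCommGroup N] [Module A N] (f : M →ₗ[A] N) {n : ℕ}
    (x : Fin n → A) (g : Finset (Fin n) → M) (t : Finset (Fin n)) :
    diff N x (fun s => f (g s)) t = f (diff M x g t) := by
  simp [diff_apply, map_sum]

theorem diff_algebraMap {B : Type*} [CommRing B] [Algebra A B] [Module B M] [IsScalarTower A B M]
    {n : ℕ} (x : Fin n → A) (g : Finset (Fin n) → M) :
    diff M (fun j => algebraMap A B (x j)) g = diff M x g := by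
  funext t
  refine sum_congr rfl fun j _ => ?_
  rw [← algebraMap_smul B ((-1 : A) ^ _ * x j)]
  simp

theorem koszulMap_restrict {n : ℕ} (x : Fin n → A) (i : ℕ) (g : Finset (Fin n) → M)
    (t : {s : Finset (Fin n) // #s = i + 1}) :
    koszulMap A M x i (fun s => g s.1) t = diff M x g t.1 :=
  sum_attach t.1 fun j => ((-1 : A) ^ #{k ∈ t.1 | k < j} * x j) • g (t.1.erase j)

/-- Exactness of the Koszul cochain complex in degree `i`, stated with ungraded cochains. -/
def ExactAt (M : Type*) [AddCommGroup M] [Module A M] {n : ℕ} (x : Fin n → A) (i : ℕ) : Prop :=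
  ∀ g : Finset (Fin n) → M, (∀ t, #t = i + 1 → diff M x g t = 0) →
    ∃ h, ∀ s, #s = i → g s = diff M x h s

theorem exists_extend {n i : ℕ} (g : {s : Finset (Fin n) // #s = i} → M) :
    ∃ g' : Finset (Fin n) → M, g = fun s => g' s.1 := by
  classical
  exact ⟨fun s => if h : #s = i then g ⟨s, h⟩ else 0, funext fun s => by simp [s.2]⟩

theorem not_koszulCohomologyNeZero_iff {n : ℕ} (x : Fin n → A) (i : ℕ) :
    ¬ koszulCohomologyNeZero A M x i ↔ ExactAt M x i := by
  cases i with
  | zero =>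
    simp only [koszulCohomologyNeZero, not_not, LinearMap.ker_eq_bot']
    constructor
    · intro H g hg
      refine ⟨0, fun s hs => ?_⟩
      have := congrFun (H (fun s => g s.1) (funext fun t => by
        rw [koszulMap_restrict, hg _ t.2, Pi.zero_apply])) ⟨s, hs⟩
      simpa using this
    · intro H g hg
      obtain ⟨g, rfl⟩ := exists_extend g
      obtain ⟨h, hh⟩ := H g fun t ht => by
        rw [← koszulMap_restrict x 0 g ⟨t, ht⟩, hg, Pi.zero_apply]
      funext s
      rw [hh _ s.2, card_eq_zero.1 s.2, diff_empty, Pi.zero_apply]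
  | succ i =>
    simp only [koszulCohomologyNeZero, not_not]
    constructor
    · intro H g hg
      obtain ⟨h, hh⟩ := H (x := fun s => g s.1) (funext fun t => by
        rw [koszulMap_restrict, hg _ t.2, Pi.zero_apply])
      obtain ⟨h, rfl⟩ := exists_extend h
      refine ⟨h, fun s hs => ?_⟩
      rw [← koszulMap_restrict x i h ⟨s, hs⟩, hh]
    · intro H g hg
      obtain ⟨g, rfl⟩ := exists_extend g
      obtain ⟨h, hh⟩ := H g fun t ht => by
        rw [← koszulMap_restrict x (i + 1) g ⟨t, ht⟩, hg, Pi.zero_apply]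
      exact ⟨fun s => h s.1, funext fun s => by rw [koszulMap_restrict, hh _ s.2]⟩

/-- Contraction with the `j`-th basis vector is a homotopy from multiplication by `x j` to zero. -/
theorem ExactAt.exists_smul_eq {n : ℕ} (x : Fin n → A) (j : Fin n) {i : ℕ}
    {g : Finset (Fin n) → M} (hg : ∀ t, #t = i + 1 → diff M x g t = 0) :
    ∃ h, ∀ s, #s = i → x j • g s = diff M x h s := by
  let e : Finset (Fin n) → A := fun s => (-1) ^ #{k ∈ s | k < j}
  have he : ∀ s, e s * e s = 1 := fun s => by simp [e, ← mul_pow]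
  refine ⟨fun s => if j ∈ s then 0 else e s • g (insert j s), fun s hs => ?_⟩
  rw [diff_apply]
  by_cases hj : j ∈ s
  · rw [sum_eq_single_of_mem j hj fun l hl hlj => by simp [hj, hlj.symm]]
    have : e (s.erase j) = e s := by
      simp only [e]
      congr 2
      ext k
      simp only [mem_filter, mem_erase]
      exact ⟨fun h => ⟨h.1.2, h.2⟩, fun h => ⟨⟨h.2.ne, h.1⟩, h.2⟩⟩
    rw [if_neg (by simp), insert_erase hj, smul_smul, this, mul_right_comm, he, one_mul]
  · have h0 := hg (insert j s) (by rw [card_insert_of_notMem hj, hs])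
    rw [diff_apply, sum_insert hj, erase_insert hj] at h0
    have h1 : #{k ∈ insert j s | k < j} = #{k ∈ s | k < j} := by
      rw [filter_insert, if_neg (lt_irrefl j)]
    rw [h1] at h0
    have h2 := congrArg (e s • ·) (eq_neg_of_add_eq_zero_left h0)
    simp only [smul_smul, ← mul_assoc, smul_neg] at h2
    change (e s * e s * x j) • g s = _ at h2
    rw [he, one_mul] at h2
    rw [h2, smul_sum, ← sum_neg_distrib]
    refine sum_congr rfl fun l hl => ?_
    have hlj : l ≠ j := fun h => hj (h ▸ hl)
    rw [if_neg (by simp [hj]), smul_smul, smul_smul, ← neg_smul,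
      erase_insert_of_ne hlj.symm]
    congr 1
    simp only [e]
    rcases lt_or_gt_of_ne hlj with h | h
    · have h3 : #{k ∈ insert j s | k < l} = #{k ∈ s | k < l} := by
        rw [filter_insert, if_neg h.not_gt]
      have h4 : #{k ∈ s | k < j} = #{k ∈ s.erase l | k < j} + 1 := by
        rw [filter_erase, card_erase_add_one (by simp [hl, h])]
      rw [h3, h4]
      ring
    · have h3 : #{k ∈ insert j s | k < l} = #{k ∈ s | k < l} + 1 := by
        rw [filter_insert, if_pos h, card_insert_of_notMem (by simp [hj])]
      have h4 : #{k ∈ s.erase l | k < j} = #{k ∈ s | k < j} := by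
        rw [filter_erase, erase_eq_of_notMem (by simp [h.not_gt])]
      rw [h3, h4]
      ring

theorem diff_comp_rev {n : ℕ} (x : Fin n → A) (g : Finset (Fin n) → M) (t : Finset (Fin n)) :
    diff M (fun j => x j.rev) g t =
      (-1 : A) ^ (#t - 1) • diff M x (fun s => g (s.map Fin.revPerm.toEmbedding))
        (t.map Fin.revPerm.toEmbedding) := by
  rw [diff_apply, diff_apply, sum_map, smul_sum]
  refine sum_congr rfl fun j hj => ?_
  have h1 : ((t.map Fin.revPerm.toEmbedding).erase (Fin.revPerm.toEmbedding j)).map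
      Fin.revPerm.toEmbedding = t.erase j := by
    rw [← map_erase, map_map]
    convert map_refl
    ext k
    simp
  have h2 : #{k ∈ t.map Fin.revPerm.toEmbedding | k < Fin.revPerm.toEmbedding j} =
      #{k ∈ t | j < k} := by
    rw [filter_map, card_map]
    congr 1
    ext k
    simp
  have h3 : #t - 1 = #{k ∈ t | k < j} + #{k ∈ t | j < k} := by
    rw [← card_erase_of_mem hj, ← card_union_of_disjoint]
    · congr 1
      ext k
      simp only [mem_erase, mem_union, mem_filter, ← and_or_left, ← ne_iff_lt_or_gt]
      exact and_comm
    · exact disjoint_filter.2 fun k _ h => h.not_gt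
  rw [h1, h2, h3, smul_smul, ← mul_assoc, ← pow_add, add_assoc, pow_add]
  have : (-1 : A) ^ (#{k ∈ t | j < k} + #{k ∈ t | j < k}) = 1 := by
    rw [← two_mul, pow_mul]
    simp
  rw [this, mul_one]
  rfl

theorem ExactAt.comp_rev {n : ℕ} {x : Fin n → A} {i : ℕ} (H : ExactAt M x i) :
    ExactAt M (fun j => x j.rev) i := by
  intro g hg
  have hrr : ∀ t : Finset (Fin n),
      (t.map Fin.revPerm.toEmbedding).map Fin.revPerm.toEmbedding = t := fun t => by
    rw [map_map]
    convert map_refl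
    ext k
    simp
  have hsq : ∀ k, (-1 : A) ^ k * (-1) ^ k = 1 := fun k => by simp [← mul_pow]
  obtain ⟨h, hh⟩ := H (fun s => g (s.map Fin.revPerm.toEmbedding)) fun t ht => by
    have := hg (t.map Fin.revPerm.toEmbedding) (by rw [card_map, ht])
    rw [diff_comp_rev, hrr] at this
    have := congrArg ((-1 : A) ^ (#(t.map Fin.revPerm.toEmbedding) - 1) • ·) this
    simpa only [smul_smul, hsq, one_smul, smul_zero] using this
  refine ⟨(-1 : A) ^ (i - 1) • fun s => h (s.map Fin.revPerm.toEmbedding), fun s hs => ?_⟩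
  have := hh (s.map Fin.revPerm.toEmbedding) (by rw [card_map, hs])
  rw [hrr] at this
  rw [this, map_smul, Pi.smul_apply, diff_comp_rev, hs, smul_smul, hsq, one_smul]
  simp only [hrr]

end Differential

section Cons

variable {A : Type*} [CommRing A] {M : Type*} [AddCommGroup M] [Module A M]

theorem diff_cons_map {n : ℕ} (y : A) (x : Fin n → A) (g : Finset (Fin (n + 1)) → M)
    (s : Finset (Fin n)) :
    diff M (Fin.cons y x : Fin (n + 1) → A) g (s.map (Fin.succEmb n)) =
      diff M x (fun s => g (s.map (Fin.succEmb n))) s := by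
  rw [diff_apply, diff_apply, sum_map]
  refine sum_congr rfl fun j _ => ?_
  rw [filter_map, card_map, ← map_erase]
  simp [Function.comp_def]

theorem diff_cons_insert {n : ℕ} (y : A) (x : Fin n → A) (g : Finset (Fin (n + 1)) → M)
    (s : Finset (Fin n)) :
    diff M (Fin.cons y x : Fin (n + 1) → A) g (insert 0 (s.map (Fin.succEmb n))) =
      y • g (s.map (Fin.succEmb n)) -
        diff M x (fun s => g (insert 0 (s.map (Fin.succEmb n)))) s := by
  have h0 : (0 : Fin (n + 1)) ∉ s.map (Fin.succEmb n) := by simp [Fin.succ_ne_zero]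
  rw [diff_apply, sum_insert h0, erase_insert h0, sum_map, sub_eq_add_neg, diff_apply,
    ← sum_neg_distrib]
  congr 1
  · simp
  · refine sum_congr rfl fun j _ => ?_
    have : #{k ∈ insert 0 (s.map (Fin.succEmb n)) | k < Fin.succEmb n j} =
        #{k ∈ s | k < j} + 1 := by
      rw [filter_insert, if_pos (by simp),
        card_insert_of_notMem fun h => h0 (mem_of_mem_filter _ h),
        filter_map, card_map]
      simp [Function.comp_def]
    rw [this, erase_insert_of_ne (by simpa using (Fin.succ_ne_zero j).symm), ← map_erase,
      pow_succ, ← neg_smul]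
    simp

theorem exists_map_or_insert {n : ℕ} (t : Finset (Fin (n + 1))) :
    ∃ s : Finset (Fin n), t = s.map (Fin.succEmb n) ∨ t = insert 0 (s.map (Fin.succEmb n)) := by
  refine ⟨univ.filter fun j => j.succ ∈ t, ?_⟩
  by_cases h : 0 ∈ t
  · right
    ext k
    cases k using Fin.cases <;> simp [h, Fin.succ_ne_zero]
  · left
    ext k
    cases k using Fin.cases <;> simp [h, Fin.succ_ne_zero]

theorem exists_cochain_cons {X : Type*} {n : ℕ} (u v : Finset (Fin n) → X) :
    ∃ g : Finset (Fin (n + 1)) → X, (fun s => g (s.map (Fin.succEmb n))) = u ∧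
      (fun s => g (insert 0 (s.map (Fin.succEmb n)))) = v := by
  refine ⟨fun t => if 0 ∈ t then v (univ.filter fun j => j.succ ∈ t)
    else u (univ.filter fun j => j.succ ∈ t), ?_, ?_⟩ <;> funext s <;> simp [Fin.succ_ne_zero]

theorem card_insert_map_succ {n : ℕ} (s : Finset (Fin n)) :
    #(insert 0 (s.map (Fin.succEmb n))) = #s + 1 := by
  rw [card_insert_of_notMem (by simp [Fin.succ_ne_zero]), card_map]

theorem ExactAt.cons {n : ℕ} {x : Fin n → A} {k : ℕ} (H : ∀ i < k, ExactAt M x i) (y : A) :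
    ∀ i < k, ExactAt M (Fin.cons y x : Fin (n + 1) → A) i := by
  intro i hi g hg
  obtain ⟨p, hp⟩ := H i hi (fun s => g (s.map (Fin.succEmb n))) fun t ht => by
    rw [← diff_cons_map y, hg _ (by rw [card_map, ht])]
  obtain ⟨q, hq⟩ : ∃ q, ∀ s : Finset (Fin n), #s + 1 = i →
      g (insert 0 (s.map (Fin.succEmb n))) - y • p s = diff M x q s := by
    cases i with
    | zero => exact ⟨0, fun s hs => by omega⟩
    | succ i =>
      obtain ⟨q, hq⟩ := H i (by omega)
        ((fun s => g (insert 0 (s.map (Fin.succEmb n)))) - y • p) fun t ht => by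
          have := hg (insert 0 (t.map (Fin.succEmb n))) (by rw [card_insert_map_succ, ht])
          rw [diff_cons_insert, hp t ht, sub_eq_zero] at this
          rw [map_sub, map_smul, Pi.sub_apply, ← this, Pi.smul_apply, sub_self]
      exact ⟨q, fun s hs => hq s (by omega)⟩
  obtain ⟨h, hu, hv⟩ := exists_cochain_cons p (-q)
  refine ⟨h, fun t ht => ?_⟩
  obtain ⟨s, rfl | rfl⟩ := exists_map_or_insert t
  · rw [diff_cons_map, hu]
    exact hp s (by rwa [card_map] at ht)
  · rw [diff_cons_insert, hv, congrFun hu s, map_neg, Pi.neg_apply, sub_neg_eq_add,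
      ← hq s (by rwa [card_insert_map_succ] at ht)]
    abel

theorem exists_smul_eq_of_mem_span {n : ℕ} {x : Fin n → A} {a : A}
    (ha : a ∈ Ideal.span (Set.range x)) {i : ℕ} {g : Finset (Fin n) → M}
    (hg : ∀ t, #t = i + 1 → diff M x g t = 0) :
    ∃ h, ∀ s, #s = i → a • g s = diff M x h s := by
  induction ha using Submodule.span_induction with
  | mem a ha =>
    obtain ⟨j, rfl⟩ := ha
    exact ExactAt.exists_smul_eq x j hg
  | zero => exact ⟨0, fun s _ => by simp⟩
  | add a b _ _ ha hb =>
    obtain ⟨p, hp⟩ := ha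
    obtain ⟨q, hq⟩ := hb
    exact ⟨p + q, fun s hs => by rw [add_smul, hp s hs, hq s hs, map_add, Pi.add_apply]⟩
  | smul c a _ ha =>
    obtain ⟨p, hp⟩ := ha
    exact ⟨c • p, fun s hs => by rw [smul_assoc, hp s hs, map_smul, Pi.smul_apply]⟩

theorem ExactAt.of_cons {n : ℕ} {x : Fin n → A} {i : ℕ} {z : A}
    (hz : z ∈ (Ideal.span (Set.range x)).radical)
    (H : ExactAt M (Fin.cons z x : Fin (n + 1) → A) i) : ExactAt M x i := by
  obtain ⟨m, hm⟩ := hz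
  intro g hg
  have hgm := exists_smul_eq_of_mem_span hm hg
  clear hm
  induction m with
  | zero => simpa using hgm
  | succ m ih =>
    refine ih ?_
    obtain ⟨w, hw⟩ := hgm
    obtain ⟨e, hu, hv⟩ := exists_cochain_cons (z ^ m • g) w
    obtain ⟨h, hh⟩ := H e fun t ht => by
      obtain ⟨s, rfl | rfl⟩ := exists_map_or_insert t
      · rw [card_map] at ht
        rw [diff_cons_map, hu, map_smul, Pi.smul_apply, hg s ht, smul_zero]
      · rw [card_insert_map_succ, add_left_inj] at ht
        rw [diff_cons_insert, hv, congrFun hu s, ← hw s ht, Pi.smul_apply, smul_smul, ← pow_succ',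
          sub_self]
    refine ⟨fun s => h (s.map (Fin.succEmb n)), fun s hs => ?_⟩
    have := hh (s.map (Fin.succEmb n)) (by rwa [card_map])
    rwa [congrFun hu s, diff_cons_map] at this

end Cons

section Module

variable {A : Type*} [CommRing A] {M : Type*} [AddCommGroup M] [Module A M]
  {N : Type*} [AddCommGroup N] [Module A N] {n : ℕ} {x : Fin n → A} {i : ℕ}

theorem ExactAt.of_retract (f : N →ₗ[A] M) (r : M →ₗ[A] N) (hr : ∀ a, r (f a) = a)
    (H : ExactAt M x i) : ExactAt N x i := by
  intro g hg
  obtain ⟨h, hh⟩ := H (fun s => f (g s)) fun t ht => by rw [diff_comp, hg t ht, map_zero]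
  refine ⟨fun s => r (h s), fun s hs => ?_⟩
  rw [diff_comp, ← hh s hs, hr]

theorem ExactAt.of_decomposition {P : Type*} [AddCommGroup P] [Module A P]
    (f : M →ₗ[A] P) (r : P →ₗ[A] M) (f' : N →ₗ[A] P) (r' : P →ₗ[A] N)
    (hr : ∀ a, f (r a) + f' (r' a) = a) (H : ExactAt M x i) (H' : ExactAt N x i) :
    ExactAt P x i := by
  intro g hg
  obtain ⟨h, hh⟩ := H (fun s => r (g s)) fun t ht => by rw [diff_comp, hg t ht, map_zero]
  obtain ⟨h', hh'⟩ := H' (fun s => r' (g s)) fun t ht => by rw [diff_comp, hg t ht, map_zero]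
  refine ⟨(fun s => f (h s)) + fun s => f' (h' s), fun s hs => ?_⟩
  rw [map_add, Pi.add_apply, diff_comp, diff_comp, ← hh s hs, ← hh' s hs, hr]

theorem exactAt_algebraMap {B : Type*} [CommRing B] [Algebra A B] [Module B M]
    [IsScalarTower A B M] :
    ExactAt M (fun j => algebraMap A B (x j)) i ↔ ExactAt M x i := by
  simp only [ExactAt, diff_algebraMap]

theorem ExactAt.localization (S : Submonoid A) {B : Type*} [CommRing B] [Algebra A B]
    [IsLocalization S B] (H : ExactAt A x i) : ExactAt B x i := by
  intro g hg
  obtain ⟨b, hb⟩ := IsLocalization.exist_integer_multiples_of_finite S g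
  choose g' hg' using hb
  have hd : ∀ t, algebraMap A B (diff A x g' t) = b • diff B x g t := fun t => by
    have h1 := diff_comp (Algebra.linearMap A B) x g' t
    simp only [Algebra.linearMap_apply, hg'] at h1
    rw [← h1]
    exact congrFun ((diff B x).map_smul (b : A) g) t
  have hex : ∀ t : {t : Finset (Fin n) // #t = i + 1}, ∃ c : S, (c : A) * diff A x g' t = 0 :=
    fun t => (IsLocalization.map_eq_zero_iff S B _).1 (by rw [hd, hg t.1 t.2, smul_zero])
  choose c hc using hex
  obtain ⟨h, hh⟩ := H (((∏ t, c t : S) : A) • g') fun t ht => by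
    rw [map_smul, Pi.smul_apply, smul_eq_mul, ← mul_prod_erase univ c (mem_univ ⟨t, ht⟩),
      Submonoid.coe_mul, mul_right_comm, hc ⟨t, ht⟩, zero_mul]
  let u : S := (∏ t, c t) * b
  refine ⟨fun s => IsLocalization.mk' B (h s) u, fun s hs => ?_⟩
  have hu : IsUnit (algebraMap A B u) := IsLocalization.map_units B u
  apply hu.mul_left_cancel
  rw [← Algebra.smul_def, ← Algebra.smul_def]
  have h3 : (u : A) • diff B x (fun s => IsLocalization.mk' B (h s) u) s =
      diff B x ((u : A) • fun s => IsLocalization.mk' B (h s) u) s := by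
    rw [map_smul, Pi.smul_apply]
  have h2 : ((u : A) • fun s => IsLocalization.mk' B (h s) u) =
      fun s => Algebra.linearMap A B (h s) := by
    funext s
    rw [Pi.smul_apply, Algebra.smul_def, mul_comm, IsLocalization.mk'_spec]
    rfl
  rw [h3, h2, diff_comp, ← hh s hs]
  simp only [Pi.smul_apply, smul_eq_mul, Algebra.linearMap_apply, map_mul, hg', u,
    Submonoid.coe_mul, Algebra.smul_def]
  ring

theorem span_eq_top_of_exactAt {x : Fin n → A} (H : ExactAt A x n) :
    Ideal.span (Set.range x) = ⊤ := by
  obtain ⟨h, hh⟩ := H 1 fun t ht => by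
    have := card_le_univ t
    rw [Fintype.card_fin] at this
    omega
  rw [Ideal.eq_top_iff_one]
  have := hh univ (by simp)
  rw [Pi.one_apply] at this
  rw [this, diff_apply]
  refine sum_mem fun j _ => ?_
  rw [smul_eq_mul, mul_right_comm]
  exact Ideal.mul_mem_left _ _ (Ideal.subset_span ⟨j, rfl⟩)

end Module

section Grade

variable {A : Type*} [CommRing A] {M : Type*} [AddCommGroup M] [Module A M]

/-- Exactness of the Koszul cochain complex of the list `L` on `M` in all degrees below `k`. -/
def ExactBelow (M : Type*) [AddCommGroup M] [Module A M] (L : List A) (k : ℕ) : Prop :=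
  ∀ i < k, ExactAt M L.get i

theorem exactBelow_ofFn {n : ℕ} (x : Fin n → A) (k : ℕ) :
    ExactBelow M (List.ofFn x) k ↔ ∀ i < k, ExactAt M x i := by
  have h : ∀ p q : Σ n, Fin n → A, p = q →
      ((∀ i < k, ExactAt M p.2 i) ↔ ∀ i < k, ExactAt M q.2 i) := by
    rintro p _ rfl
    rfl
  exact h _ _ (List.equivSigmaTuple.apply_symm_apply ⟨n, x⟩)

theorem get_cons_eq {X : Type*} (y : X) (L : List X) : (y :: L).get = Fin.cons y L.get := by
  funext j
  cases j using Fin.cases <;> rfl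

theorem ExactBelow.append {L : List A} {k : ℕ} (H : ExactBelow M L k) (L' : List A) :
    ExactBelow M (L' ++ L) k := by
  induction L' with
  | nil => exact H
  | cons y L' ih =>
    have := ExactAt.cons ih y
    rwa [← get_cons_eq] at this

theorem ExactBelow.of_append {L L' : List A} {k : ℕ}
    (hL' : ∀ z ∈ L', z ∈ (Ideal.span {a | a ∈ L}).radical) (H : ExactBelow M (L' ++ L) k) :
    ExactBelow M L k := by
  induction L' with
  | nil => exact H
  | cons z L' ih =>
    refine ih (fun w hw => hL' w (List.mem_cons_of_mem _ hw)) fun i hi => ?_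
    have hi' := H i hi
    rw [List.cons_append, get_cons_eq] at hi'
    refine hi'.of_cons (Ideal.radical_mono (Ideal.span_mono ?_) (hL' z List.mem_cons_self))
    rw [Set.range_list_get]
    exact fun a ha => List.mem_append_right _ ha

theorem ExactBelow.reverse {L : List A} {k : ℕ} (H : ExactBelow M L k) :
    ExactBelow M L.reverse k := by
  have : L.reverse = List.ofFn fun j => L.get j.rev := by
    refine List.ext_getElem (by simp) fun i _ _ => ?_
    simp [List.getElem_reverse, Fin.val_rev, Nat.sub_add_eq, Nat.sub_right_comm]
  rw [this, exactBelow_ofFn]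
  exact fun i hi => (H i hi).comp_rev

/-- Koszul exactness passes to any list generating, up to radical, a larger ideal. -/
theorem ExactBelow.of_mem_radical {L Z : List A} {k : ℕ} (H : ExactBelow M Z k)
    (hZ : ∀ z ∈ Z, z ∈ (Ideal.span {a | a ∈ L}).radical) : ExactBelow M L k := by
  refine ExactBelow.of_append (L' := Z.reverse) (fun z hz => hZ z (List.mem_reverse.1 hz)) ?_
  simpa using (H.append L.reverse).reverse

theorem ExactBelow.of_subset {L Z : List A} {k : ℕ} (H : ExactBelow M Z k)
    (hZ : ∀ z ∈ Z, z ∈ L) : ExactBelow M L k :=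
  H.of_mem_radical fun z hz => Ideal.le_radical (Ideal.subset_span (hZ z hz))

theorem exactBelow_map_algebraMap {B : Type*} [CommRing B] [Algebra A B] [Module B M]
    [IsScalarTower A B M] {L : List A} {k : ℕ} :
    ExactBelow M (L.map (algebraMap A B)) k ↔ ExactBelow M L k := by
  have : L.map (algebraMap A B) = List.ofFn fun j => algebraMap A B (L.get j) := by
    refine List.ext_getElem (by simp) fun i _ _ => ?_
    simp
  rw [this, exactBelow_ofFn]
  simp only [exactAt_algebraMap, ExactBelow]

theorem natCast_le_kgrSeq_iff {n : ℕ} (x : Fin n → A) (k : ℕ) :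
    (k : ℕ∞) ≤ kgrSeq A M x ↔ ∀ i < k, ExactAt M x i := by
  simp only [kgrSeq, le_sInf_iff, Set.mem_ofPred_eq, ← not_koszulCohomologyNeZero_iff]
  constructor
  · intro H i hi h
    exact absurd (H i ⟨i, rfl, h⟩) (by simpa using hi)
  · rintro H _ ⟨i, rfl, h⟩
    by_contra hlt
    exact H i (by simpa using hlt) h

theorem natCast_le_kgr_iff {𝔞 : Ideal A} {k : ℕ} :
    (k : ℕ∞) ≤ kgr A 𝔞 M ↔ ∃ L : List A, (∀ a ∈ L, a ∈ 𝔞) ∧ ExactBelow M L k := by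
  constructor
  · intro H
    rcases k with _ | k
    · exact ⟨[], by simp, fun i hi => absurd hi (Nat.not_lt_zero i)⟩
    · have : (k : ℕ∞) < kgr A 𝔞 M :=
        lt_of_lt_of_le (by exact_mod_cast Nat.lt_succ_self k) H
      simp only [kgr, lt_iSup_iff] at this
      obtain ⟨n, x, hx, h⟩ := this
      refine ⟨List.ofFn x, by simpa [List.mem_ofFn] using hx, (exactBelow_ofFn x _).2 ?_⟩
      rw [← natCast_le_kgrSeq_iff]
      exact_mod_cast Order.add_one_le_of_lt h
  · rintro ⟨L, hL, H⟩
    refine ((natCast_le_kgrSeq_iff L.get k).2 H).trans ?_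
    exact le_iSup_of_le L.length <| le_iSup_of_le L.get <|
      le_iSup_of_le (fun j => hL _ (List.get_mem L j)) le_rfl

end Grade

section Height

variable {A : Type*} [CommRing A]

/-- A prime containing `I`, `x` and the ideal of all `w` with `w * x ∈ √I` is not minimal
over `I`. -/
theorem exists_isPrime_lt_of_boundary_le {I q : Ideal A} [q.IsPrime] {x : A} (hx : x ∈ q)
    (hb : ∀ w, w * x ∈ I.radical → w ∈ q) : ∃ p : Ideal A, p.IsPrime ∧ I ≤ p ∧ p < q := by
  have hdisj : Disjoint (I : Set A) (q.primeCompl ⊔ Submonoid.powers x : Submonoid A) := by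
    refine Set.disjoint_left.2 fun a haI haS => ?_
    obtain ⟨s, hs, _, ⟨n, rfl⟩, rfl⟩ := Submonoid.mem_sup.1 haS
    refine hs (hb s ⟨n + 1, ?_⟩)
    have : (s * x) ^ (n + 1) = s ^ n * x * (s * x ^ n) := by ring
    rw [this]
    exact I.mul_mem_left _ haI
  obtain ⟨p, hp, hIp, hpS⟩ := Ideal.exists_le_prime_disjoint I _ hdisj
  have hpq : p ≤ q := fun a ha => by
    by_contra haq
    exact Set.disjoint_left.1 hpS ha (Submonoid.mem_sup_left (x := a) haq)
  exact ⟨p, hp, hIp, lt_of_le_of_ne hpq fun h => Set.disjoint_left.1 hpS (h.symm ▸ hx : x ∈ p)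
    (Submonoid.mem_sup_right (Submonoid.mem_powers x))⟩

/-- Kronecker's theorem for local rings: if `I` has codimension at most `h` in the maximal ideal,
then `h` nonunits can be modified by multiples of the nonunit `u` so that the radical of the ideal
they generate over `I` contains `u`. -/
theorem exists_list_of_length_le [IsLocalRing A] {u : A} (hu : u ∈ IsLocalRing.maximalIdeal A)
    (L : List A) (hL : ∀ x ∈ L, x ∈ IsLocalRing.maximalIdeal A) (I : Ideal A)
    (hI : ∀ c : LTSeries (PrimeSpectrum A), I ≤ c.head.asIdeal → c.length ≤ L.length) :
    ∃ L' : List A, L'.length = L.length ∧ (∀ x ∈ L', x ∈ IsLocalRing.maximalIdeal A) ∧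
      (∀ P : Ideal A, u ∈ P → (∀ x ∈ L', x ∈ P) → ∀ x ∈ L, x ∈ P) ∧
      ∀ P : Ideal A, P.IsPrime → I ≤ P → (∀ x ∈ L', x ∈ P) → u ∈ P := by
  induction L generalizing I with
  | nil =>
    refine ⟨[], rfl, by simp, by simp, fun P hP hIP _ => ?_⟩
    have hPm := IsLocalRing.le_maximalIdeal hP.ne_top
    rcases hPm.lt_or_eq with h | rfl
    · let c : LTSeries (PrimeSpectrum A) :=
        { length := 1
          toFun := ![⟨P, hP⟩, IsLocalRing.closedPoint A]
          step := fun i => by fin_cases i; exact h }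
      exact absurd (hI c hIP) (by simp [c])
    · exact hu
  | cons x L ih =>
    have hx := hL x List.mem_cons_self
    let K : Ideal A := I ⊔ Ideal.span {x} ⊔ Submodule.comap (LinearMap.mulRight A x) I.radical
    obtain ⟨L', hlen, hL'm, hLL', hL'⟩ := ih (fun y hy => hL y (List.mem_cons_of_mem _ hy)) K
      fun c hc => by
        obtain ⟨p, hp, hIp, hpq⟩ := exists_isPrime_lt_of_boundary_le (I := I) (x := x)
          (q := c.head.asIdeal)
          (hc (Ideal.mem_sup_left (Ideal.mem_sup_right (Ideal.mem_span_singleton_self x))))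
          fun w hw => hc (Ideal.mem_sup_right hw)
        simpa using hI (c.cons ⟨p, hp⟩ hpq) (by simpa using hIp)
    obtain ⟨m, hm⟩ : u ∈ (K ⊔ Ideal.span {a | a ∈ L'}).radical := by
      rw [Ideal.radical_eq_sInf, Submodule.mem_sInf]
      rintro P ⟨hKP, hP⟩
      exact hL' P hP (le_sup_left.trans hKP) fun y hy =>
        hKP (Ideal.mem_sup_right (Ideal.subset_span hy))
    obtain ⟨b, hb, a, ha, hba⟩ := Submodule.mem_sup.1 hm
    obtain ⟨c, hc, w, hw, hcw⟩ := Submodule.mem_sup.1 hb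
    have hwx : w * x ∈ I.radical := hw
    refine ⟨(x + u * w) :: L', by simp [hlen], ?_, fun P huP hP' => ?_, fun P hP hIP hP' => ?_⟩
    · simp only [List.mem_cons, forall_eq_or_imp]
      exact ⟨add_mem hx (Ideal.mul_mem_right _ _ hu), hL'm⟩
    · simp only [List.mem_cons, forall_eq_or_imp] at hP' ⊢
      exact ⟨(Ideal.add_mem_iff_left P (P.mul_mem_right w huP)).1 hP'.1, hLL' P huP hP'.2⟩
    · simp only [List.mem_cons, forall_eq_or_imp] at hP'
      obtain ⟨hxw, hP'⟩ := hP'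
      by_contra huP
      have hiff : x ∈ P ↔ w ∈ P :=
        ⟨fun h => (hP.mem_or_mem ((Ideal.add_mem_iff_right P h).1 hxw)).resolve_left huP,
          fun h => (Ideal.add_mem_iff_left P (P.mul_mem_left u h)).1 hxw⟩
      have hxP : x ∈ P := (hP.mem_or_mem (hP.radical_le_iff.2 hIP hwx)).elim hiff.2 id
      refine huP (hP.mem_of_pow_mem m ?_)
      rw [← hba, ← hcw]
      refine add_mem (add_mem ?_ (hiff.1 hxP)) (Ideal.span_le.2 hP' ha)
      exact sup_le hIP ((Ideal.span_singleton_le_iff_mem P).2 hxP) hc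

theorem exists_list_mem_radical [IsLocalRing A] {h : ℕ}
    (hh : ∀ c : LTSeries (PrimeSpectrum A), c.length ≤ h) (Z : List A)
    (hZ : ∀ z ∈ Z, z ∈ IsLocalRing.maximalIdeal A) :
    ∃ L : List A, L.length = h ∧ (∀ x ∈ L, x ∈ IsLocalRing.maximalIdeal A) ∧
      ∀ z ∈ Z, z ∈ (Ideal.span {a | a ∈ L}).radical := by
  induction Z with
  | nil => exact ⟨List.replicate h 0, by simp, by simp +contextual [List.mem_replicate], by simp⟩
  | cons u Z ih =>
    obtain ⟨L, rfl, hLm, hL⟩ := ih fun z hz => hZ z (List.mem_cons_of_mem _ hz)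
    obtain ⟨L', hlen, hL'm, hLL', hL'⟩ :=
      exists_list_of_length_le (hZ u List.mem_cons_self) L hLm ⊥ fun c _ => hh c
    refine ⟨L', hlen, hL'm, ?_⟩
    suffices H : ∀ P : Ideal A, Ideal.span {a | a ∈ L'} ≤ P → P.IsPrime → ∀ z ∈ u :: Z, z ∈ P by
      intro z hz
      rw [Ideal.radical_eq_sInf, Submodule.mem_sInf]
      exact fun P hP => H P hP.1 hP.2 z hz
    intro P hP hPprime
    have hP' : ∀ x ∈ L', x ∈ P := fun x hx => hP (Ideal.subset_span hx)
    have huP := hL' P hPprime bot_le hP'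
    simp only [List.mem_cons, forall_eq_or_imp]
    exact ⟨huP, fun z hz => hPprime.radical_le_iff.2 (Ideal.span_le.2 (hLL' P huP hP')) (hL z hz)⟩

theorem kgr_le_height (p : PrimeSpectrum A) : kgr A p.asIdeal A ≤ Order.height p := by
  rw [← ENat.forall_natCast_le_iff_le]
  intro k hk
  obtain ⟨Z, hZ, H⟩ := natCast_le_kgr_iff.1 hk
  by_contra hlt
  obtain ⟨h, hh⟩ := ENat.ne_top_iff_exists.1 (lt_of_not_ge hlt).ne_top
  rw [← hh, Nat.cast_le, not_le] at hlt
  let B := Localization.AtPrime p.asIdeal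
  have hdim : ∀ c : LTSeries (PrimeSpectrum B), c.length ≤ h := fun c => by
    have := Order.LTSeries.length_le_krullDim c
    change _ ≤ ringKrullDim B at this
    rw [IsLocalization.AtPrime.ringKrullDim_eq_height p.asIdeal B,
      PrimeSpectrum.height_eq_orderHeight, ← hh] at this
    exact_mod_cast this
  obtain ⟨L, rfl, hLm, hL⟩ := exists_list_mem_radical hdim (Z.map (algebraMap A B)) fun z hz => by
    obtain ⟨a, ha, rfl⟩ := List.mem_map.1 hz
    exact (IsLocalization.AtPrime.to_map_mem_maximal_iff B p.asIdeal a).2 (hZ a ha)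
  have HB : ExactBelow B (Z.map (algebraMap A B)) k := exactBelow_map_algebraMap.2
    fun i hi => (H i hi).localization p.asIdeal.primeCompl
  have htop := span_eq_top_of_exactAt (HB.of_mem_radical hL _ hlt)
  refine (IsLocalRing.maximalIdeal.isMaximal B).ne_top (top_le_iff.1 ?_)
  rw [← htop, Set.range_list_get]
  exact Ideal.span_le.2 hLm

/-- The Koszul grade of an ideal is at most its height, in any commutative ring. -/
theorem kgr_le_idealHeight (𝔞 : Ideal A) : kgr A 𝔞 A ≤ idealHeight A 𝔞 := by
  refine le_iInf₂ fun p hp => le_trans ?_ (kgr_le_height p)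
  rw [← ENat.forall_natCast_le_iff_le]
  intro k hk
  obtain ⟨Z, hZ, H⟩ := natCast_le_kgr_iff.1 hk
  exact natCast_le_kgr_iff.2 ⟨Z, fun a ha => hp (hZ a ha), H⟩

end Height

section Retractions

variable {A R : Type*} [CommRing A] [CommRing R] [Algebra A R] {p₁ p₂ : R →+* A}

theorem isIntegral_of_retractions (h₁ : ∀ a, p₁ (algebraMap A R a) = a)
    (h₂ : ∀ a, p₂ (algebraMap A R a) = a) (h : ∀ z, p₁ z = 0 → p₂ z = 0 → z = 0) :
    Algebra.IsIntegral A R := by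
  refine ⟨fun z => ⟨(Polynomial.X - Polynomial.C (p₁ z)) * (Polynomial.X - Polynomial.C (p₂ z)),
    (Polynomial.monic_X_sub_C _).mul (Polynomial.monic_X_sub_C _), h _ ?_ ?_⟩⟩ <;>
  simp [h₁, h₂]

theorem comap_comap_eq_of_retraction {p : R →+* A} (hp : ∀ a, p (algebraMap A R a) = a)
    {q : Ideal R} (hq : RingHom.ker p ≤ q) : (q.comap (algebraMap A R)).comap p = q := by
  ext z
  have hz : z - algebraMap A R (p z) ∈ q := hq (by simp [RingHom.mem_ker, hp])
  rw [Ideal.mem_comap, Ideal.mem_comap]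
  exact ⟨fun h => by simpa using add_mem hz h, fun h => by simpa using sub_mem h hz⟩

theorem height_le_height_comap_of_retraction {p : R →+* A}
    (hp : ∀ a, p (algebraMap A R a) = a) (q : PrimeSpectrum A) :
    Order.height q ≤ Order.height (PrimeSpectrum.comap p q) := by
  refine Order.height_le_height_apply_of_strictMono (PrimeSpectrum.comap p)
    (Monotone.strictMono_of_injective (fun _ _ h => Ideal.comap_mono h) fun q q' h => ?_) q
  ext a
  have := congrArg (fun P : PrimeSpectrum R => algebraMap A R a ∈ P.asIdeal) h
  simpa [hp] using this

theorem height_comap_algebraMap_le (h₁ : ∀ a, p₁ (algebraMap A R a) = a)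
    (h₂ : ∀ a, p₂ (algebraMap A R a) = a) (h : ∀ z, p₁ z = 0 → p₂ z = 0 → z = 0)
    (q : PrimeSpectrum R) :
    Order.height (PrimeSpectrum.comap (algebraMap A R) q) ≤ Order.height q := by
  have key : ∀ p : R →+* A, (∀ a, p (algebraMap A R a) = a) → RingHom.ker p ≤ q.asIdeal →
      Order.height (PrimeSpectrum.comap (algebraMap A R) q) ≤ Order.height q := by
    intro p hp hq
    refine (height_le_height_comap_of_retraction hp _).trans_eq (congrArg _ ?_)
    exact PrimeSpectrum.ext (comap_comap_eq_of_retraction hp hq)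
  have hker : RingHom.ker p₁ * RingHom.ker p₂ ≤ q.asIdeal := by
    refine Ideal.mul_le.2 fun a ha b hb => ?_
    have ha' : p₁ a = 0 := ha
    have hb' : p₂ b = 0 := hb
    rw [h (a * b) (by simp [ha']) (by simp [hb'])]
    exact zero_mem _
  exact (q.isPrime.mul_le.1 hker).elim (key p₁ h₁) (key p₂ h₂)

theorem idealHeight_le_idealHeight_map (h₁ : ∀ a, p₁ (algebraMap A R a) = a)
    (h₂ : ∀ a, p₂ (algebraMap A R a) = a) (h : ∀ z, p₁ z = 0 → p₂ z = 0 → z = 0) (𝔞 : Ideal A) :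
    idealHeight A 𝔞 ≤ idealHeight R (𝔞.map (algebraMap A R)) :=
  le_iInf₂ fun q hq => (iInf₂_le (PrimeSpectrum.comap (algebraMap A R) q)
    (Ideal.map_le_iff_le_comap.1 hq)).trans (height_comap_algebraMap_le h₁ h₂ h q)

end Retractions

section Integral

variable {A R : Type*} [CommRing A] [CommRing R] [Algebra A R]

theorem idealHeight_le_idealHeight_comap [Algebra.IsIntegral A R] (𝔟 : Ideal R) :
    idealHeight R 𝔟 ≤ idealHeight A (𝔟.comap (algebraMap A R)) := by
  refine le_iInf₂ fun p hp => ?_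
  obtain ⟨Q, hQ, hQP, hcomap⟩ := Ideal.exists_ideal_over_prime_of_isIntegral p.asIdeal 𝔟 hp
  refine (iInf₂_le (⟨Q, hQP⟩ : PrimeSpectrum R) hQ).trans ?_
  have : p = PrimeSpectrum.comap (algebraMap A R) ⟨Q, hQP⟩ := PrimeSpectrum.ext hcomap.symm
  rw [this]
  exact Order.height_le_height_apply_of_strictMono (PrimeSpectrum.comap (algebraMap A R))
    (fun P P' hlt => Ideal.IsIntegral.comap_lt_comap (show P.asIdeal < P'.asIdeal from hlt)) _

end Integral

section Decomposition

variable {A R : Type*} [CommRing A] [CommRing R] [Algebra A R]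
  {N : Type*} [AddCommGroup N] [Module A N]

theorem exactBelow_iff_of_linearEquiv (e : R ≃ₗ[A] A × N) (L : List A) (k : ℕ) :
    ExactBelow R (L.map (algebraMap A R)) k ↔ ExactBelow A L k ∧ ExactBelow N L k := by
  rw [exactBelow_map_algebraMap]
  constructor
  · intro H
    exact ⟨fun i hi => (H i hi).of_retract (e.symm.toLinearMap ∘ₗ LinearMap.inl A A N)
        (LinearMap.fst A A N ∘ₗ e.toLinearMap) (by simp),
      fun i hi => (H i hi).of_retract (e.symm.toLinearMap ∘ₗ LinearMap.inr A A N)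
        (LinearMap.snd A A N ∘ₗ e.toLinearMap) (by simp)⟩
  · rintro ⟨H, H'⟩ i hi
    refine ExactAt.of_decomposition (e.symm.toLinearMap ∘ₗ LinearMap.inl A A N)
      (LinearMap.fst A A N ∘ₗ e.toLinearMap) (e.symm.toLinearMap ∘ₗ LinearMap.inr A A N)
      (LinearMap.snd A A N ∘ₗ e.toLinearMap) (fun a => ?_) (H i hi) (H' i hi)
    simp [← map_add]

theorem exists_list_of_mem_map (𝔞 : Ideal A) (Z : List R)
    (hZ : ∀ z ∈ Z, z ∈ 𝔞.map (algebraMap A R)) :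
    ∃ L : List A, (∀ a ∈ L, a ∈ 𝔞) ∧
      ∀ z ∈ Z, z ∈ Ideal.span {b | b ∈ L.map (algebraMap A R)} := by
  induction Z with
  | nil => exact ⟨[], by simp, by simp⟩
  | cons z Z ih =>
    obtain ⟨L, hL, hLZ⟩ := ih fun w hw => hZ w (List.mem_cons_of_mem _ hw)
    obtain ⟨T, hT, hzT⟩ := Submodule.mem_span_finite_of_mem_span (hZ z List.mem_cons_self)
    have hT' : ∀ w ∈ T.toList, w ∈ algebraMap A R '' 𝔞 := fun w hw => hT (mem_toList.1 hw)
    choose! c hc using hT'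
    refine ⟨T.toList.map c ++ L, ?_, ?_⟩
    · intro a ha
      rcases List.mem_append.1 ha with ha | ha
      · obtain ⟨w, hw, rfl⟩ := List.mem_map.1 ha
        exact (hc w hw).1
      · exact hL a ha
    · simp only [List.mem_cons, forall_eq_or_imp]
      refine ⟨Ideal.span_mono (fun w hw => ?_) hzT,
        fun w hw => Ideal.span_mono (fun v hv => ?_) (hLZ w hw)⟩
      · have hw' := mem_toList.2 (mem_coe.1 hw)
        exact List.mem_map.2 ⟨c w, List.mem_append_left _ (List.mem_map_of_mem hw'), (hc w hw').2⟩
      · obtain ⟨a, ha, rfl⟩ := List.mem_map.1 hv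
        exact List.mem_map_of_mem (List.mem_append_right _ ha)

theorem kgr_map_le (e : R ≃ₗ[A] A × N) (𝔞 : Ideal A) :
    kgr R (𝔞.map (algebraMap A R)) R ≤ min (kgr A 𝔞 A) (kgr A 𝔞 N) := by
  rw [← ENat.forall_natCast_le_iff_le]
  intro k hk
  obtain ⟨Z, hZ, H⟩ := natCast_le_kgr_iff.1 hk
  obtain ⟨L, hL, hLZ⟩ := exists_list_of_mem_map 𝔞 Z hZ
  obtain ⟨HA, HN⟩ := (exactBelow_iff_of_linearEquiv e L k).1
    (H.of_mem_radical fun z hz => Ideal.le_radical (hLZ z hz))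
  exact le_min (natCast_le_kgr_iff.2 ⟨L, hL, HA⟩) (natCast_le_kgr_iff.2 ⟨L, hL, HN⟩)

theorem min_kgr_comap_le (e : R ≃ₗ[A] A × N) (𝔟 : Ideal R) :
    min (kgr A (𝔟.comap (algebraMap A R)) A) (kgr A (𝔟.comap (algebraMap A R)) N) ≤
      kgr R 𝔟 R := by
  rw [← ENat.forall_natCast_le_iff_le]
  intro k hk
  obtain ⟨L, hL, H⟩ := natCast_le_kgr_iff.1 (hk.trans (min_le_left _ _))
  obtain ⟨L', hL', H'⟩ := natCast_le_kgr_iff.1 (hk.trans (min_le_right _ _))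
  refine natCast_le_kgr_iff.2 ⟨(L ++ L').map (algebraMap A R), fun b hb => ?_,
    (exactBelow_iff_of_linearEquiv e _ k).2
      ⟨H.of_subset fun _ => List.mem_append_left _, H'.of_subset fun _ => List.mem_append_right _⟩⟩
  obtain ⟨a, ha, rfl⟩ := List.mem_map.1 hb
  exact (List.mem_append.1 ha).elim (hL a) (hL' a)

theorem isCMIdeals_iff_of_linearEquiv {p₁ p₂ : R →+* A} (h₁ : ∀ a, p₁ (algebraMap A R a) = a)
    (h₂ : ∀ a, p₂ (algebraMap A R a) = a) (h : ∀ z, p₁ z = 0 → p₂ z = 0 → z = 0)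
    (e : R ≃ₗ[A] A × N) :
    IsCMIdeals R ↔ IsCMIdeals A ∧ ∀ 𝔞 : Ideal A, idealHeight A 𝔞 ≤ kgr A 𝔞 N := by
  constructor
  · intro H
    have key : ∀ 𝔞 : Ideal A, idealHeight A 𝔞 ≤ min (kgr A 𝔞 A) (kgr A 𝔞 N) := fun 𝔞 =>
      (idealHeight_le_idealHeight_map h₁ h₂ h 𝔞).trans ((H _).trans_le (kgr_map_le e 𝔞))
    exact ⟨fun 𝔞 => ((key 𝔞).trans (min_le_left _ _)).antisymm (kgr_le_idealHeight 𝔞),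
      fun 𝔞 => (key 𝔞).trans (min_le_right _ _)⟩
  · rintro ⟨HA, HN⟩ 𝔟
    have := isIntegral_of_retractions h₁ h₂ h
    exact ((idealHeight_le_idealHeight_comap 𝔟).trans
      ((le_min (HA _).le (HN _)).trans (min_kgr_comap_le e 𝔟))).antisymm (kgr_le_idealHeight 𝔟)

end Decomposition

end Koszul

/-- The structure of an `A`-algebra on `A ⋈^f J` given by `ι_A`. -/
instance amalgAlgebra {A B : Type*} [CommRing A] [CommRing B] (f : A →+* B) (J : Ideal B) :
    Algebra A (amalgamation f J) :=
  (amalgIota f J).toAlgebra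

/-- The `A`-module `A ⋈ J` is `A ⊕ J`. -/
def duplicationEquiv {A : Type*} [CommRing A] (J : Ideal A) :
    amalgamation (RingHom.id A) J ≃ₗ[A] A × J where
  toFun z := (z.1.1, ⟨z.1.2 - z.1.1, z.2⟩)
  invFun w := ⟨(w.1, w.1 + w.2), show w.1 + w.2 - w.1 ∈ J by simp⟩
  map_add' z w := Prod.ext rfl (Subtype.ext (add_sub_add_comm _ _ _ _))
  map_smul' a z := Prod.ext rfl (Subtype.ext (mul_sub _ _ _).symm)
  left_inv z := Subtype.ext (Prod.ext rfl (add_sub_cancel _ _))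
  right_inv w := Prod.ext rfl (Subtype.ext (add_sub_cancel_left _ _))

/-- The amalgamated duplication `A⋈J = A⋈^{id_A} J` of `A` along an
ideal `J` is Cohen-Macaulay in the sense of ideals iff `A` is Cohen-Macaulay in the
sense of ideals and `kgr_A(𝔞, J) ≥ height 𝔞` for every ideal `𝔞` of `A`. -/
theorem isCMIdeals_duplication_iff {A : Type*} [CommRing A] (J : Ideal A) :
    IsCMIdeals ↥(amalgamation (RingHom.id A) J) ↔
      IsCMIdeals A ∧ ∀ 𝔞 : Ideal A, idealHeight A 𝔞 ≤ kgr A 𝔞 J := by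
  exact Koszul.isCMIdeals_iff_of_linearEquiv
    (p₁ := (RingHom.fst A A).comp (amalgamation (RingHom.id A) J).subtype)
    (p₂ := (RingHom.snd A A).comp (amalgamation (RingHom.id A) J).subtype)
    (fun _ => rfl) (fun _ => rfl) (fun _ h₁ h₂ => Subtype.ext (Prod.ext h₁ h₂))
    (duplicationEquiv J)
end
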